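/- arXiv:2108.06560 — 7 statements merged into one kernel-verified Lean document; each statement's English description precedes it below -/
import Mathlib

section
/- Let 1 ≤ l ≤ g and let z_1, …, z_l and z'_1, …, z'_l be elements of (ℂ ∪ {∞}) ∖ {b_1^{±1}, …, b_g^{±1}}. Then ∏_{j=1}^l r_i(z_j) = ∏_{j=1}^l r_i(z'_j) holds for every i = 1, …, g if and only if there exists an integer k with 2k ≤ l such that, after permuting the z_j and permuting the z'_j, each of the pairs (z_1,z_2), …, (z_{2k−1},z_{2k}) and (z'_1,z'_2), …, (z'_{2k−1},z'_{2k}) consists of mutually inverse points of ℂ ∪ {∞} (i.e. the product of the two entries equals 1, where the pair (0, ∞) also counts as mutually inverse), and z_j = z'_j for all j > 2k. -/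
/-- The map `r_b` on `ℂ ∪ {∞}` (modelled as `Option ℂ`, with `none = ∞`):
`r_b(z) = (z - b)/(z - b⁻¹)` for finite `z`, and `r_b(∞) = 1`. -/
noncomputable def rr (b : ℂ) : Option ℂ → ℂ :=
  fun z => z.elim 1 (fun w => (w - b) / (w - b⁻¹))

/-- Two points of `ℂ ∪ {∞}` are mutually inverse: the product of the two entries
equals `1`, where the pair `(0, ∞)` (in either order) also counts as mutually inverse. -/
def MutInv : Option ℂ → Option ℂ → Prop
  | some a, some c => a * c = 1
  | some a, none => a = 0
  | none, some c => c = 0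
  | none, none => False

open Polynomial in
/-- A polynomial in the parameter `b` vanishing exactly when `z = b`. -/
private noncomputable def fwdPoly (z : Option ℂ) : ℂ[X] :=
  z.elim 1 (fun w => C w - X)

open Polynomial in
/-- A polynomial in the parameter `b` vanishing exactly when `z` is the inverse of `b`. -/
private noncomputable def invPoly (z : Option ℂ) : ℂ[X] :=
  z.elim X (fun w => X * C w - 1)

private def HasInvPair (s : Multiset (Option ℂ)) : Prop :=
  ∃ a c u, s = a ::ₘ c ::ₘ u ∧ MutInv a c

private lemma MutInv.rr_mul_rr {b : ℂ} (hb : b ≠ 0) {a c : Option ℂ} (h : MutInv a c)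
    (ha : a ≠ some b ∧ a ≠ some b⁻¹) (hc : c ≠ some b ∧ c ≠ some b⁻¹) :
    rr b a * rr b c = b ^ 2 := by
  rcases a with _ | a <;> rcases c with _ | c
  · exact h.elim
  · have h : c = 0 := h
    subst h
    simp [rr]
    field_simp
  · have h : a = 0 := h
    subst h
    simp [rr]
    field_simp
  · have h : a * c = 1 := h
    have h1 : a - b⁻¹ ≠ 0 := fun h => ha.2 (by rw [sub_eq_zero.1 h])
    have h2 : c - b⁻¹ ≠ 0 := fun h => hc.2 (by rw [sub_eq_zero.1 h])
    simp only [rr, Option.elim]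
    rw [div_mul_div_comm, div_eq_iff (mul_ne_zero h1 h2)]
    field_simp
    linear_combination (1 - b ^ 2) * h

private lemma rr_ne_zero {b : ℂ} {z : Option ℂ} (h : z ≠ some b ∧ z ≠ some b⁻¹) :
    rr b z ≠ 0 := by
  rcases z with _ | w
  · simp [rr]
  · have h1 : w - b⁻¹ ≠ 0 := fun e => h.2 (by rw [sub_eq_zero.1 e])
    have h2 : w - b ≠ 0 := fun e => h.1 (by rw [sub_eq_zero.1 e])
    exact div_ne_zero h2 h1

private lemma eval_fwdPoly {b : ℂ} (hb : b ≠ 0) {z : Option ℂ} (h : z ≠ some b ∧ z ≠ some b⁻¹) :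
    (fwdPoly z).eval b = rr b z * (b⁻¹ * (invPoly z).eval b) := by
  rcases z with _ | w
  · simp [rr, fwdPoly, invPoly, hb]
  · have h1 : w - b⁻¹ ≠ 0 := fun e => h.2 (by rw [sub_eq_zero.1 e])
    have h2 : b⁻¹ * (b * w - 1) = w - b⁻¹ := by field_simp
    simp only [rr, fwdPoly, invPoly, Option.elim, Polynomial.eval_sub, Polynomial.eval_mul,
      Polynomial.eval_X, Polynomial.eval_C, Polynomial.eval_one]
    rw [h2, div_mul_cancel₀ _ h1]

private lemma eval_inv_fwdPoly {b : ℂ} (hb : b ≠ 0) (z : Option ℂ) :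
    (fwdPoly z).eval b⁻¹ = b⁻¹ * (invPoly z).eval b := by
  rcases z with _ | w
  · simp [fwdPoly, invPoly, hb]
  · simp [fwdPoly, invPoly]
    field_simp

private lemma eval_inv_invPoly {b : ℂ} (hb : b ≠ 0) (z : Option ℂ) :
    (invPoly z).eval b⁻¹ = b⁻¹ * (fwdPoly z).eval b := by
  rcases z with _ | w
  · simp [fwdPoly, invPoly]
  · simp [fwdPoly, invPoly]
    field_simp

private lemma eval_one_fwdPoly (z : Option ℂ) : (fwdPoly z).eval 1 = (invPoly z).eval 1 := by
  rcases z with _ | w <;> simp [fwdPoly, invPoly]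

private lemma natDegree_fwdPoly_le (z : Option ℂ) : (fwdPoly z).natDegree ≤ 1 := by
  rcases z with _ | w
  · simp [fwdPoly]
  · simp only [fwdPoly, Option.elim]
    compute_degree

private lemma natDegree_invPoly_le (z : Option ℂ) : (invPoly z).natDegree ≤ 1 := by
  rcases z with _ | w
  · simp [invPoly]
  · simp only [invPoly, Option.elim]
    compute_degree

open Polynomial in
private lemma natDegree_prod_map_le {ι : Type*} (f : ι → ℂ[X]) (hf : ∀ i, (f i).natDegree ≤ 1)
    (s : Multiset ι) : (s.map f).prod.natDegree ≤ s.card := by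
  refine (natDegree_multiset_prod_le _).trans ?_
  refine (Multiset.sum_le_card_nsmul _ 1 ?_).trans (by simp)
  intro x hx
  simp only [Multiset.mem_map] at hx
  obtain ⟨_, ⟨i, _, rfl⟩, rfl⟩ := hx
  exact hf i

open Polynomial in
private lemma eval_prod_map {ι : Type*} (f : ι → ℂ[X]) (x : ℂ) (s : Multiset ι) :
    (s.map f).prod.eval x = (s.map fun i => (f i).eval x).prod := by
  rw [eval_multiset_prod, Multiset.map_map]
  rfl

/-- The polynomial identity equivalent to equality of the products of `r_b`
over `s` and `t` for all `b`. -/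
private lemma prod_fwdPoly_mul_prod_invPoly {g : ℕ} {b : Fin g → ℂ} (hb0 : ∀ i, b i ≠ 0)
    (hbinj : Function.Injective b) (hbInv : ∀ i j, b i ≠ (b j)⁻¹)
    {s t : Multiset (Option ℂ)} (hcard : s.card = t.card) (hle : s.card ≤ g)
    (hs : ∀ z ∈ s, ∀ i, z ≠ some (b i) ∧ z ≠ some (b i)⁻¹)
    (ht : ∀ z ∈ t, ∀ i, z ≠ some (b i) ∧ z ≠ some (b i)⁻¹)
    (h : ∀ i, (s.map (rr (b i))).prod = (t.map (rr (b i))).prod) :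
    (s.map fwdPoly).prod * (t.map invPoly).prod =
      (t.map fwdPoly).prod * (s.map invPoly).prod := by
  have key : ∀ (i : Fin g) (u : Multiset (Option ℂ)),
      (∀ z ∈ u, ∀ i, z ≠ some (b i) ∧ z ≠ some (b i)⁻¹) →
      (u.map fwdPoly).prod.eval (b i) =
        (u.map (rr (b i))).prod * ((b i)⁻¹ ^ u.card * (u.map invPoly).prod.eval (b i)) := by
    intro i u hu
    rw [eval_prod_map, eval_prod_map,
      Multiset.map_congr rfl fun z hz => eval_fwdPoly (hb0 i) (hu z hz i), Multiset.prod_map_mul,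
      Multiset.prod_map_mul, Multiset.map_const', Multiset.prod_replicate]
  have keyF : ∀ (i : Fin g) (u : Multiset (Option ℂ)), (u.map fwdPoly).prod.eval (b i)⁻¹ =
      (b i)⁻¹ ^ u.card * (u.map invPoly).prod.eval (b i) := by
    intro i u
    rw [eval_prod_map, eval_prod_map,
      Multiset.map_congr rfl fun z _ => eval_inv_fwdPoly (hb0 i) z, Multiset.prod_map_mul,
      Multiset.map_const', Multiset.prod_replicate]
  have keyI : ∀ (i : Fin g) (u : Multiset (Option ℂ)), (u.map invPoly).prod.eval (b i)⁻¹ =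
      (b i)⁻¹ ^ u.card * (u.map fwdPoly).prod.eval (b i) := by
    intro i u
    rw [eval_prod_map, eval_prod_map,
      Multiset.map_congr rfl fun z _ => eval_inv_invPoly (hb0 i) z, Multiset.prod_map_mul,
      Multiset.map_const', Multiset.prod_replicate]
  have hb1 : ∀ i, b i ≠ 1 := fun i e => hbInv i i (by simp [e])
  have main : ∀ i, (s.map fwdPoly).prod.eval (b i) * (t.map invPoly).prod.eval (b i) =
      (t.map fwdPoly).prod.eval (b i) * (s.map invPoly).prod.eval (b i) := by
    intro i
    rw [key i s hs, key i t ht, h i, hcard]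
    ring
  rw [← sub_eq_zero]
  let f : Option (Fin g ⊕ Fin g) → ℂ :=
    fun o => o.elim 1 (Sum.elim b fun i => (b i)⁻¹)
  have hf : Function.Injective f := by
    rintro (_ | i | i) (_ | j | j) hij
    · rfl
    · exact (hb1 j hij.symm).elim
    · exact (hb1 j (inv_eq_one.1 (Eq.symm hij))).elim
    · exact (hb1 i hij).elim
    · rw [hbinj hij]
    · exact (hbInv i j hij).elim
    · exact (hb1 i (inv_eq_one.1 hij)).elim
    · exact (hbInv j i (Eq.symm hij)).elim
    · rw [hbinj (inv_injective hij)]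
  refine Polynomial.eq_zero_of_natDegree_lt_card_of_eval_eq_zero _ hf ?_ ?_
  · rintro (_ | i | i)
    · simp only [f, Option.elim, Polynomial.eval_sub, Polynomial.eval_mul, eval_prod_map,
        eval_one_fwdPoly]
      ring
    · simp only [f, Option.elim, Sum.elim_inl, Polynomial.eval_sub, Polynomial.eval_mul]
      rw [main i, sub_self]
    · simp only [f, Option.elim, Sum.elim_inr, Polynomial.eval_sub, Polynomial.eval_mul,
        keyF, keyI, hcard]
      linear_combination (-(b i)⁻¹ ^ t.card * (b i)⁻¹ ^ t.card) * main i
  · have h1 := natDegree_prod_map_le _ natDegree_fwdPoly_le s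
    have h2 := natDegree_prod_map_le _ natDegree_invPoly_le s
    have h3 := natDegree_prod_map_le _ natDegree_fwdPoly_le t
    have h4 := natDegree_prod_map_le _ natDegree_invPoly_le t
    refine (Polynomial.natDegree_sub_le_of_le (m := 2 * g) (n := 2 * g) ?_ ?_).trans_lt ?_
    · exact Polynomial.natDegree_mul_le.trans (by omega)
    · exact Polynomial.natDegree_mul_le.trans (by omega)
    · simp
      omega

private lemma mem_or_exists_mutInv {s t : Multiset (Option ℂ)}
    (h : (s.map fwdPoly).prod * (t.map invPoly).prod =
      (t.map fwdPoly).prod * (s.map invPoly).prod)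
    {w : Option ℂ} (hw : w ∈ s) : w ∈ t ∨ ∃ c ∈ s, MutInv w c := by
  rcases w with _ | w
  · have h0 := congrArg (Polynomial.eval 0) h
    rw [Polynomial.eval_mul, Polynomial.eval_mul] at h0
    simp only [eval_prod_map] at h0
    rw [Multiset.prod_eq_zero (s := s.map fun i => (invPoly i).eval 0)
      (Multiset.mem_map.2 ⟨none, hw, by simp [invPoly]⟩), mul_zero, mul_eq_zero,
      Multiset.prod_eq_zero_iff, Multiset.prod_eq_zero_iff, Multiset.mem_map, Multiset.mem_map]
      at h0
    rcases h0 with ⟨_ | c, hc, e⟩ | ⟨_ | c, hc, e⟩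
    · simp [fwdPoly] at e
    · exact Or.inr ⟨some c, hc, show c = 0 by simpa [fwdPoly] using e⟩
    · exact Or.inl hc
    · simp [invPoly] at e
  · have h0 := congrArg (Polynomial.eval w) h
    rw [Polynomial.eval_mul, Polynomial.eval_mul] at h0
    simp only [eval_prod_map] at h0
    rw [Multiset.prod_eq_zero (s := s.map fun i => (fwdPoly i).eval w)
      (Multiset.mem_map.2 ⟨some w, hw, by simp [fwdPoly]⟩), zero_mul, eq_comm, mul_eq_zero,
      Multiset.prod_eq_zero_iff, Multiset.prod_eq_zero_iff, Multiset.mem_map, Multiset.mem_map]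
      at h0
    rcases h0 with ⟨_ | c, hc, e⟩ | ⟨_ | c, hc, e⟩
    · simp [fwdPoly] at e
    · have e : c - w = 0 := by simpa [fwdPoly] using e
      rw [sub_eq_zero.1 e] at hc
      exact Or.inl hc
    · exact Or.inr ⟨none, hc, show w = 0 by simpa [invPoly] using e⟩
    · have e : w * c - 1 = 0 := by
        simpa only [invPoly, Option.elim, Polynomial.eval_sub, Polynomial.eval_mul,
          Polynomial.eval_X, Polynomial.eval_C, Polynomial.eval_one] using e
      exact Or.inr ⟨some c, hc, sub_eq_zero.1 e⟩

private lemma MutInv.eq_one_or_neg_one {w : Option ℂ} (h : MutInv w w) :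
    w = some 1 ∨ w = some (-1) := by
  rcases w with _ | w
  · exact h.elim
  · have h : w * w = 1 := h
    simpa using mul_self_eq_one_iff.1 h

private lemma rr_some_one {b : ℂ} (hb : b ≠ 0) (h : b ≠ 1) : rr b (some 1) = -b := by
  have h1 : 1 - b⁻¹ ≠ 0 := fun e => h (inv_eq_one.1 (sub_eq_zero.1 e).symm)
  simp only [rr, Option.elim]
  rw [div_eq_iff h1]
  field_simp
  ring

private lemma rr_some_neg_one {b : ℂ} (hb : b ≠ 0) (h : b ≠ -1) : rr b (some (-1)) = b := by
  have h1 : -1 - b⁻¹ ≠ 0 := fun e => h (by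
    rw [← inv_inv b, ← sub_eq_zero.1 e]
    norm_num)
  simp only [rr, Option.elim]
  rw [div_eq_iff h1]
  field_simp
  ring

private lemma eq_zero_of_not_hasInvPair {g : ℕ} {b : Fin g → ℂ} (hb0 : ∀ i, b i ≠ 0)
    (hbinj : Function.Injective b) (hbInv : ∀ i j, b i ≠ (b j)⁻¹)
    {s t : Multiset (Option ℂ)} (hcard : s.card = t.card) (hle : s.card ≤ g)
    (hs : ∀ z ∈ s, ∀ i, z ≠ some (b i) ∧ z ≠ some (b i)⁻¹)
    (ht : ∀ z ∈ t, ∀ i, z ≠ some (b i) ∧ z ≠ some (b i)⁻¹)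
    (h : ∀ i, (s.map (rr (b i))).prod = (t.map (rr (b i))).prod)
    (hdisj : ∀ z ∈ s, z ∉ t) (hpair : ¬ HasInvPair s) : s = 0 := by
  have hid := prod_fwdPoly_mul_prod_invPoly hb0 hbinj hbInv hcard hle hs ht h
  have hself : ∀ w ∈ s, MutInv w w := by
    intro w hw
    obtain hwt | ⟨c, hc, hwc⟩ := mem_or_exists_mutInv hid hw
    · exact (hdisj w hw hwt).elim
    · by_cases hcw : c = w
      · rwa [hcw] at hwc
      · obtain ⟨u, rfl⟩ := Multiset.exists_cons_of_mem hw
        obtain ⟨v, rfl⟩ := Multiset.exists_cons_of_mem ((Multiset.mem_cons.1 hc).resolve_left hcw)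
        exact (hpair ⟨w, c, v, rfl, hwc⟩).elim
  have hnodup : s.Nodup := by
    rw [Multiset.nodup_iff_le]
    intro a ha
    obtain ⟨u, hu⟩ := Multiset.le_iff_exists_add.1 ha
    refine hpair ⟨a, a, u, by simp [hu], hself a ?_⟩
    rw [hu]
    simp
  have hsub : s ≤ {some 1, some (-1)} := by
    rw [Multiset.le_iff_subset hnodup]
    intro w hw
    simpa using (hself w hw).eq_one_or_neg_one
  have hinv : ∀ w ∈ t, ∃ c ∈ t, MutInv w c := fun w hw =>
    (mem_or_exists_mutInv hid.symm hw).resolve_left fun hws => hdisj w hws hw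
  by_contra hs0
  have hpos : 0 < s.card := Multiset.card_pos.2 hs0
  let i : Fin g := ⟨0, by omega⟩
  have hb : b i ≠ 0 := hb0 i
  have hb1 : b i ≠ 1 := fun e => hbInv i i (by simp [e])
  have hbn : b i ≠ -1 := fun e => hbInv i i (by rw [e]; norm_num)
  have hone : ∀ v, t = {v} → v = some 1 ∨ v = some (-1) := by
    rintro v rfl
    obtain ⟨c, hc, hvc⟩ := hinv v (by simp)
    rw [Multiset.mem_singleton.1 hc] at hvc
    exact hvc.eq_one_or_neg_one
  have hi := h i
  have hcases : s = {some 1} ∨ s = {some (-1)} ∨ s = {some 1, some (-1)} := by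
    have hm := Multiset.mem_powerset.2 hsub
    have e : ({some 1, some (-1)} : Multiset (Option ℂ)) = some 1 ::ₘ some (-1) ::ₘ 0 := rfl
    rw [e] at hm
    simp only [Multiset.powerset_cons, Multiset.powerset_zero, Multiset.mem_add,
      Multiset.map_add, Multiset.map_singleton, Multiset.mem_singleton] at hm
    rcases hm with (hm | hm) | (hm | hm)
    · exact (hs0 hm).elim
    · exact Or.inr (Or.inl hm)
    · exact Or.inl hm
    · exact Or.inr (Or.inr hm)
  rcases hcases with rfl | rfl | rfl
  · obtain ⟨v, rfl⟩ := Multiset.card_eq_one.1 (hcard.symm.trans (by simp))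
    rcases hone v rfl with rfl | rfl
    · exact hdisj (some 1) (by simp) (by simp)
    · simp [rr_some_one hb hb1, rr_some_neg_one hb hbn] at hi
      exact hb (self_eq_neg.1 hi.symm)
  · obtain ⟨v, rfl⟩ := Multiset.card_eq_one.1 (hcard.symm.trans (by simp))
    rcases hone v rfl with rfl | rfl
    · simp [rr_some_one hb hb1, rr_some_neg_one hb hbn] at hi
      exact hb (self_eq_neg.1 hi)
    · exact hdisj (some (-1)) (by simp) (by simp)
  · obtain ⟨u, v, rfl⟩ := Multiset.card_eq_two.1 (hcard.symm.trans (by simp))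
    have huv : MutInv u v := by
      obtain ⟨c, hc, huc⟩ := hinv u (by simp)
      have hc : c = u ∨ c = v := by simpa using hc
      rcases hc with rfl | rfl
      · exact (hdisj c (by simpa using huc.eq_one_or_neg_one) (by simp)).elim
      · exact huc
    have hprod := huv.rr_mul_rr hb (ht u (by simp) i) (ht v (by simp) i)
    simp [rr_some_one hb hb1, rr_some_neg_one hb hbn, hprod] at hi
    have : (b i) ^ 2 = 0 := by linear_combination (-1 / 2 : ℂ) * hi
    exact hb (pow_eq_zero_iff two_ne_zero |>.1 this)

/-- Simultaneous enumerations of `s` and `t` by inverse pairs followed by common elements. -/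
private def InvPairsThenEqual (n : ℕ) (s t : Multiset (Option ℂ)) : Prop :=
  ∃ (k : ℕ) (f f' : ℕ → Option ℂ), 2 * k ≤ n ∧
    s = ∑ j ∈ Finset.range n, {f j} ∧ t = ∑ j ∈ Finset.range n, {f' j} ∧
    (∀ m < k, MutInv (f (2 * m)) (f (2 * m + 1)) ∧ MutInv (f' (2 * m)) (f' (2 * m + 1))) ∧
    ∀ j < n, 2 * k ≤ j → f j = f' j

private lemma InvPairsThenEqual.cons {n : ℕ} {s t : Multiset (Option ℂ)}
    (h : InvPairsThenEqual n s t) (a : Option ℂ) :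
    InvPairsThenEqual (n + 1) (a ::ₘ s) (a ::ₘ t) := by
  obtain ⟨k, f, f', hk, rfl, rfl, hp, he⟩ := h
  have key : ∀ F : ℕ → Option ℂ, a ::ₘ ∑ j ∈ Finset.range n, {F j} =
      ∑ j ∈ Finset.range (n + 1), {if j < n then F j else a} := by
    intro F
    rw [Finset.sum_range_succ, if_neg (lt_irrefl n), add_comm, Multiset.singleton_add]
    congr 1
    exact Finset.sum_congr rfl fun j hj => by rw [if_pos (Finset.mem_range.1 hj)]
  refine ⟨k, _, _, by omega, key f, key f', fun m hm => ?_, fun j _ hj2 => ?_⟩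
  · simpa [show 2 * m < n by omega, show 2 * m + 1 < n by omega] using hp m hm
  · split_ifs with hjn
    · exact he j hjn hj2
    · rfl

private lemma InvPairsThenEqual.cons_pairs {n : ℕ} {s t : Multiset (Option ℂ)}
    (h : InvPairsThenEqual n s t) {a c a' c' : Option ℂ} (hac : MutInv a c)
    (hac' : MutInv a' c') :
    InvPairsThenEqual (n + 2) (a ::ₘ c ::ₘ s) (a' ::ₘ c' ::ₘ t) := by
  obtain ⟨k, f, f', hk, rfl, rfl, hp, he⟩ := h
  let ins (x y : Option ℂ) (F : ℕ → Option ℂ) : ℕ → Option ℂ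
    | 0 => x
    | 1 => y
    | j + 2 => F j
  have key : ∀ x y F, x ::ₘ y ::ₘ ∑ j ∈ Finset.range n, {F j} =
      ∑ j ∈ Finset.range (n + 2), {ins x y F j} := by
    intro x y F
    rw [Finset.sum_range_succ', Finset.sum_range_succ', add_comm, Multiset.singleton_add,
      add_comm _ {ins x y F (0 + 1)}, Multiset.singleton_add]
  refine ⟨k + 1, _, _, by omega, key a c f, key a' c' f', ?_, ?_⟩
  · rintro (_ | m) hm
    · exact ⟨hac, hac'⟩
    · exact hp m (by omega)
  · rintro (_ | _ | j) hj hj2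
    · omega
    · omega
    · exact he j (by omega) (by omega)

private lemma invPairsThenEqual_of_prod_eq {g : ℕ} {b : Fin g → ℂ} (hb0 : ∀ i, b i ≠ 0)
    (hbinj : Function.Injective b) (hbInv : ∀ i j, b i ≠ (b j)⁻¹) (n : ℕ) (hn : n ≤ g)
    (s t : Multiset (Option ℂ)) (hsn : s.card = n) (htn : t.card = n)
    (hs : ∀ z ∈ s, ∀ i, z ≠ some (b i) ∧ z ≠ some (b i)⁻¹)
    (ht : ∀ z ∈ t, ∀ i, z ≠ some (b i) ∧ z ≠ some (b i)⁻¹)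
    (h : ∀ i, (s.map (rr (b i))).prod = (t.map (rr (b i))).prod) :
    InvPairsThenEqual n s t := by
  induction n using Nat.strong_induction_on generalizing s t with
  | _ n ih =>
    by_cases hcommon : ∃ a ∈ s, a ∈ t
    · obtain ⟨a, has, hat⟩ := hcommon
      obtain ⟨s, rfl⟩ := Multiset.exists_cons_of_mem has
      obtain ⟨t, rfl⟩ := Multiset.exists_cons_of_mem hat
      rw [Multiset.card_cons] at hsn htn
      subst hsn
      refine (ih _ (Nat.lt_succ_self _) (by omega) s t rfl (by omega)
        (fun z hz => hs z (Multiset.mem_cons_of_mem hz))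
        (fun z hz => ht z (Multiset.mem_cons_of_mem hz)) fun i => ?_).cons a
      have hi := h i
      rw [Multiset.map_cons, Multiset.map_cons, Multiset.prod_cons, Multiset.prod_cons] at hi
      exact mul_left_cancel₀ (rr_ne_zero (hs a has i)) hi
    · push Not at hcommon
      by_cases hps : HasInvPair s
      · by_cases hpt : HasInvPair t
        · obtain ⟨a, c, s, rfl, hac⟩ := hps
          obtain ⟨a', c', t, rfl, hac'⟩ := hpt
          rw [Multiset.card_cons, Multiset.card_cons] at hsn htn
          subst hsn
          refine (ih _ (by omega) (by omega) s t rfl (by omega)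
            (fun z hz => hs z (by simp [hz])) (fun z hz => ht z (by simp [hz]))
            fun i => ?_).cons_pairs hac hac'
          have hi := h i
          simp only [Multiset.map_cons, Multiset.prod_cons, ← mul_assoc] at hi
          rw [hac.rr_mul_rr (hb0 i) (hs a (by simp) i) (hs c (by simp) i),
            hac'.rr_mul_rr (hb0 i) (ht a' (by simp) i) (ht c' (by simp) i)] at hi
          exact mul_left_cancel₀ (pow_ne_zero 2 (hb0 i)) hi
        · have ht0 := eq_zero_of_not_hasInvPair hb0 hbinj hbInv (htn.trans hsn.symm)
            (by omega) ht hs (fun i => (h i).symm) (fun z hz hz' => hcommon z hz' hz) hpt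
          obtain ⟨a, c, u, rfl, _⟩ := hps
          subst ht0
          simp at hsn htn
          omega
      · have hs0 := eq_zero_of_not_hasInvPair hb0 hbinj hbInv (hsn.trans htn.symm)
          (by omega) hs ht h hcommon hps
        subst hs0
        have hn0 : n = 0 := by simpa using hsn.symm
        subst hn0
        exact ⟨0, fun _ => none, fun _ => none, by simp, by simp,
          by simpa using Multiset.card_eq_zero.1 htn, by simp, by simp⟩

private lemma exists_perm_of_map_univ_eq {ι α : Type*} [Fintype ι] {f z : ι → α}
    (h : Finset.univ.val.map f = Finset.univ.val.map z) :
    ∃ σ : Equiv.Perm ι, ∀ j, z (σ j) = f j := by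
  classical
  have hcard : ∀ c, Fintype.card {j // f j = c} = Fintype.card {j // z j = c} := by
    intro c
    have hc := congrArg (Multiset.count c) h
    rw [Multiset.count_map, Multiset.count_map] at hc
    simpa only [Fintype.card_subtype, Finset.card, Finset.filter_val, eq_comm (a := c)] using hc
  let e : ∀ c, {j // f j = c} ≃ {j // z j = c} := fun c => Fintype.equivOfCardEq (hcard c)
  exact ⟨Equiv.ofFiberEquiv e, fun j => Equiv.ofFiberEquiv_map e j⟩

private lemma exists_perm_of_sum_singleton {α : Type*} {l : ℕ} (z : Fin l → α) (f : ℕ → α)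
    (h : (Finset.univ.val.map z : Multiset α) = ∑ j ∈ Finset.range l, {f j}) :
    ∃ σ : Equiv.Perm (Fin l), ∀ j, z (σ j) = f j := by
  refine exists_perm_of_map_univ_eq (f := fun j : Fin l => f j) ?_
  rw [h, Finset.sum_range]
  conv_lhs => rw [← Multiset.sum_map_singleton (Multiset.map _ _), Multiset.map_map]
  rfl

private lemma prod_range_two_mul {M : Type*} [CommMonoid M] (F : ℕ → M) (c : M) (k : ℕ)
    (h : ∀ m < k, F (2 * m) * F (2 * m + 1) = c) : ∏ j ∈ Finset.range (2 * k), F j = c ^ k := by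
  induction k with
  | zero => simp
  | succ k ih =>
    rw [Nat.mul_succ, Finset.prod_range_succ, Finset.prod_range_succ,
      ih fun m hm => h m (hm.trans k.lt_succ_self), mul_assoc, h k k.lt_succ_self, pow_succ]

theorem stmt0 (g : ℕ) (hg : 1 ≤ g) (ρ β b : Fin g → ℂ)
    (hρdist : Function.Injective ρ) (hρ1 : ∀ i, ρ i ≠ 1 ∧ ρ i ≠ -1)
    (hβ : ∀ i, β i ^ 2 = ρ i ^ 2 - 1) (hbdef : ∀ i, b i = ρ i + β i)
    (hbinj : Function.Injective b) (hbInv : ∀ i j, b i ≠ (b j)⁻¹)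
    (l : ℕ) (hl1 : 1 ≤ l) (hlg : l ≤ g)
    (z z' : Fin l → Option ℂ)
    (hz : ∀ j i, z j ≠ some (b i) ∧ z j ≠ some (b i)⁻¹)
    (hz' : ∀ j i, z' j ≠ some (b i) ∧ z' j ≠ some (b i)⁻¹) :
    (∀ i, ∏ j, rr (b i) (z j) = ∏ j, rr (b i) (z' j)) ↔
      ∃ k : ℕ, ∃ hk : 2 * k ≤ l, ∃ σ τ : Equiv.Perm (Fin l),
        (∀ m : Fin k,
          MutInv (z (σ ⟨2 * (m : ℕ), by have := m.2; omega⟩))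
                 (z (σ ⟨2 * (m : ℕ) + 1, by have := m.2; omega⟩)) ∧
          MutInv (z' (τ ⟨2 * (m : ℕ), by have := m.2; omega⟩))
                 (z' (τ ⟨2 * (m : ℕ) + 1, by have := m.2; omega⟩))) ∧
        ∀ j : Fin l, 2 * k ≤ (j : ℕ) → z (σ j) = z' (τ j) := by
  have hb0 : ∀ i, b i ≠ 0 := by
    intro i e
    have e' : β i = -ρ i := by linear_combination e - hbdef i
    have h := hβ i
    rw [e'] at h
    exact one_ne_zero (α := ℂ) (by linear_combination h)
  constructor
  · intro h
    obtain ⟨k, f, f', hk, hs, ht, hp, he⟩ := invPairsThenEqual_of_prod_eq hb0 hbinj hbInv l hlg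
      (Finset.univ.val.map z) (Finset.univ.val.map z') (by simp) (by simp)
      (by simpa using hz) (by simpa using hz')
      (fun i => by simpa only [Multiset.map_map, Function.comp_def, Finset.prod] using h i)
    obtain ⟨σ, hσ⟩ := exists_perm_of_sum_singleton z f hs
    obtain ⟨τ, hτ⟩ := exists_perm_of_sum_singleton z' f' ht
    refine ⟨k, hk, σ, τ, fun m => ?_, fun j hj => ?_⟩
    · simpa only [hσ, hτ] using hp m m.2
    · simpa only [hσ, hτ] using he j j.2 hj
  · rintro ⟨k, hk, σ, τ, hp, he⟩ i
    let ext (w : Fin l → Option ℂ) (j : ℕ) : ℂ := if hj : j < l then rr (b i) (w ⟨j, hj⟩) else 1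
    have key : ∀ (w : Fin l → Option ℂ) (π : Equiv.Perm (Fin l)),
        ∏ j, rr (b i) (w j) = ∏ j ∈ Finset.range l, ext (w ∘ π) j := by
      intro w π
      rw [Finset.prod_range, ← Equiv.prod_comp π]
      simp [ext]
    have hpairs : ∀ (w : Fin l → Option ℂ) (π : Equiv.Perm (Fin l)),
        (∀ j i, w j ≠ some (b i) ∧ w j ≠ some (b i)⁻¹) →
        (∀ m : Fin k, MutInv (w (π ⟨2 * (m : ℕ), by have := m.2; omega⟩))
          (w (π ⟨2 * (m : ℕ) + 1, by have := m.2; omega⟩))) →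
        ∏ j ∈ Finset.range (2 * k), ext (w ∘ π) j = (b i ^ 2) ^ k := by
      intro w π hw hm
      refine prod_range_two_mul _ _ _ fun m hmk => ?_
      simp only [ext, show 2 * m < l by omega, show 2 * m + 1 < l by omega, dite_true]
      exact (hm ⟨m, hmk⟩).rr_mul_rr (hb0 i) (hw _ i) (hw _ i)
    obtain ⟨d, hd⟩ := Nat.exists_eq_add_of_le hk
    rw [key z σ, key z' τ, congrArg Finset.range hd, Finset.prod_range_add,
      Finset.prod_range_add, hpairs z σ hz fun m => (hp m).1, hpairs z' τ hz' fun m => (hp m).2]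
    congr 1
    refine Finset.prod_congr rfl fun j hj => ?_
    have hjl : 2 * k + j < l := by
      have := Finset.mem_range.1 hj
      omega
    simp only [ext, hjl, dite_true, Function.comp_apply]
    rw [he ⟨2 * k + j, hjl⟩ (by simp)]
end

section
/- The multilinear polynomial F(x_1, …, x_g) = Σ_{A ∈ {0,1}^g} (−1)^a H(b_1^{1−2a_1}, …, b_g^{1−2a_g}) x_1^{a_1} ⋯ x_g^{a_g} is irreducible in the polynomial ring ℂ[x_1, …, x_g]. -/
/-- `H(u_1, …, u_g) = ∏_{i < j} (u_i - u_j)`. -/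
noncomputable def Hfun {g : ℕ} (u : Fin g → ℂ) : ℂ :=
  ∏ i : Fin g, ∏ j ∈ Finset.Ioi i, (u i - u j)

/-- `F(x_1, …, x_g) = Σ_{A ∈ {0,1}^g} (−1)^a H(b_1^{1−2a_1}, …, b_g^{1−2a_g}) x_1^{a_1} ⋯ x_g^{a_g}`,
where the subset `T` of indices corresponds to `A` (i.e. `a_i = 1 ↔ i ∈ T`). -/
noncomputable def Fpoly {g : ℕ} (b : Fin g → ℂ) : MvPolynomial (Fin g) ℂ :=
  ∑ T : Finset (Fin g),
    MvPolynomial.C ((-1 : ℂ) ^ T.card * Hfun (fun i => if i ∈ T then (b i)⁻¹ else b i)) *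
      ∏ i ∈ T, MvPolynomial.X i

open MvPolynomial in
/-- If `X i` does not occur in `Q` and `X j` does not occur in `P`, then on the coordinate plane of
`i` and `j` the product `P * Q` is a function of the `i`-th coordinate times one of the `j`-th. -/
lemma MvPolynomial.eval_indicator_mul_eval_indicator {σ K : Type*} [DecidableEq σ] [Field K]
    {P Q : MvPolynomial σ K} {i j : σ} (hi : i ∉ Q.vars) (hj : j ∉ P.vars) :
    eval (fun k => if k ∈ (∅ : Finset σ) then (1 : K) else 0) (P * Q) *
        eval (fun k => if k ∈ ({i, j} : Finset σ) then (1 : K) else 0) (P * Q) =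
      eval (fun k => if k ∈ ({i} : Finset σ) then (1 : K) else 0) (P * Q) *
        eval (fun k => if k ∈ ({j} : Finset σ) then (1 : K) else 0) (P * Q) := by
  have congr_vars (R : MvPolynomial σ K) (v w : σ → K) (h : ∀ k ∈ R.vars, v k = w k) :
      eval v R = eval w R := eval₂Hom_congr' rfl (fun k hk _ => h k hk) rfl
  have hP₁ := congr_vars P (fun k => if k ∈ ({i, j} : Finset σ) then (1 : K) else 0)
    (fun k => if k ∈ ({i} : Finset σ) then (1 : K) else 0) (by grind)
  have hP₀ := congr_vars P (fun k => if k ∈ ({j} : Finset σ) then (1 : K) else 0)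
    (fun k => if k ∈ (∅ : Finset σ) then (1 : K) else 0) (by grind)
  have hQ₁ := congr_vars Q (fun k => if k ∈ ({i, j} : Finset σ) then (1 : K) else 0)
    (fun k => if k ∈ ({j} : Finset σ) then (1 : K) else 0) (by grind)
  have hQ₀ := congr_vars Q (fun k => if k ∈ ({i} : Finset σ) then (1 : K) else 0)
    (fun k => if k ∈ (∅ : Finset σ) then (1 : K) else 0) (by grind)
  simp only [map_mul, hP₁, hP₀, hQ₁, hQ₀]
  ring

open MvPolynomial in
lemma MvPolynomial.eval_indicator_sum_C_mul_prod_X {σ K : Type*} [Fintype σ] [DecidableEq σ]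
    [Field K] (c : Finset σ → K) (U : Finset σ) :
    eval (fun k => if k ∈ U then (1 : K) else 0) (∑ T : Finset σ, C (c T) * ∏ i ∈ T, X i) =
      ∑ T ∈ U.powerset, c T := by
  have h (T : Finset σ) : (∀ i ∈ T, i ∈ U) ↔ T ∈ U.powerset := Finset.mem_powerset.symm
  simp only [map_sum, map_mul, eval_C, map_prod, eval_X, Finset.prod_ite_zero, Finset.prod_const_one,
    mul_ite, mul_one, mul_zero, h, Finset.sum_ite_mem, Finset.univ_inter]

open MvPolynomial in
lemma MvPolynomial.degreeOf_sum_C_mul_prod_X_le_one {σ K : Type*} [Fintype σ]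
    [Field K] (c : Finset σ → K) (i : σ) :
    degreeOf i (∑ T : Finset σ, C (c T) * ∏ k ∈ T, X k) ≤ 1 := by
  classical
  refine (degreeOf_sum_le _ _ _).trans (Finset.sup_le fun T _ => ?_)
  refine (degreeOf_C_mul_le _ _ _).trans ((degreeOf_prod_le _ _ _).trans ?_)
  simp only [degreeOf_X, Finset.sum_ite_eq]
  split_ifs <;> simp

open MvPolynomial in
/-- A multilinear polynomial none of whose `2 × 2` minors in the coefficients of
`1, X i, X j, X i * X j` vanishes is irreducible. -/
theorem MvPolynomial.irreducible_sum_C_mul_prod_X {σ K : Type*} [Fintype σ] [DecidableEq σ]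
    [Nonempty σ] [Field K] (c : Finset σ → K) (h₀ : c ∅ ≠ 0) (h₁ : ∀ i, c {i} ≠ 0)
    (h₂ : ∀ i j, i ≠ j → c ∅ * c {i, j} ≠ c {i} * c {j}) :
    Irreducible (∑ T : Finset σ, C (c T) * ∏ i ∈ T, X i) := by
  have eval_ind := eval_indicator_sum_C_mul_prod_X c
  have degree_le := degreeOf_sum_C_mul_prod_X_le_one c
  generalize (∑ T : Finset σ, C (c T) * ∏ i ∈ T, X i : MvPolynomial σ K) = F at *
  have hF₀ : F ≠ 0 := by
    rintro rfl
    exact h₀ (by simpa using (eval_ind ∅).symm)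
  have powerset_singleton (i : σ) : ({i} : Finset σ).powerset = {∅, {i}} := by
    ext; simp [Finset.subset_singleton_iff]
  constructor
  · intro hF
    obtain ⟨r, -, rfl⟩ := isUnit_iff_eq_C_of_isReduced.1 hF
    obtain ⟨i⟩ := ‹Nonempty σ›
    have h := eval_ind {i}
    have h' := eval_ind ∅
    rw [powerset_singleton, Finset.sum_pair (Finset.singleton_ne_empty i).symm] at h
    simp only [eval_C, Finset.powerset_empty, Finset.sum_singleton] at h h'
    exact h₁ i (by linear_combination h' - h)
  · rintro P Q rfl
    have hP₀ : P ≠ 0 := left_ne_zero_of_mul hF₀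
    have hQ₀ : Q ≠ 0 := right_ne_zero_of_mul hF₀
    have isUnit_of_vars {R : MvPolynomial σ K} (hR : R ≠ 0) (hv : R.vars = ∅) : IsUnit R := by
      rw [vars_eq_empty_iff_eq_C] at hv
      rw [hv] at hR ⊢
      exact (isUnit_iff_ne_zero.2 fun h => hR (by rw [h, C_0])).map C
    by_contra! hPQ
    obtain ⟨i, hi⟩ := Finset.nonempty_iff_ne_empty.2 (mt (isUnit_of_vars hP₀) hPQ.1)
    obtain ⟨j, hj⟩ := Finset.nonempty_iff_ne_empty.2 (mt (isUnit_of_vars hQ₀) hPQ.2)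
    have not_both (k : σ) (hkP : k ∈ P.vars) : k ∉ Q.vars := by
      intro hkQ
      have := degree_le k
      rw [degreeOf_mul_eq hP₀ hQ₀] at this
      rw [mem_vars_iff_degreeOf_ne_zero] at hkP hkQ
      omega
    have hij : i ≠ j := by
      rintro rfl
      exact not_both i hi hj
    have key := eval_indicator_mul_eval_indicator (not_both i hi) (fun h => not_both j h hj)
    have powerset_pair : ({i, j} : Finset σ).powerset = {∅, {i}, {j}, {i, j}} := by
      rw [Finset.powerset_insert, powerset_singleton]
      ext
      simp only [Finset.image_insert, Finset.image_singleton, Finset.mem_union, Finset.mem_insert,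
        Finset.mem_singleton, insert_empty_eq]
      tauto
    simp only [eval_ind, powerset_singleton, powerset_pair, Finset.powerset_empty] at key
    rw [Finset.sum_insert (by grind), Finset.sum_insert (by grind), Finset.sum_insert (by grind),
      Finset.sum_insert (by grind), Finset.sum_insert (by grind)] at key
    simp only [Finset.sum_singleton] at key
    exact h₂ i j hij (by linear_combination key)

lemma Hfun_eq_prod_pairs {g : ℕ} (u : Fin g → ℂ) :
    Hfun u = ∏ p : Fin g × Fin g with p.1 < p.2, (u p.1 - u p.2) := by
  unfold Hfun
  exact (Finset.prod_finset_product' _ Finset.univ (fun i => Finset.Ioi i) (by simp)).symm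

lemma Hfun_ne_zero {g : ℕ} {u : Fin g → ℂ} (hu : Function.Injective u) : Hfun u ≠ 0 := by
  refine Finset.prod_ne_zero_iff.2 fun i _ => Finset.prod_ne_zero_iff.2 fun j hj => ?_
  exact sub_ne_zero.2 (hu.ne (Finset.mem_Ioi.1 hj).ne)

/-- The tuple obtained from `b` by inverting the entries indexed by `T`. -/
noncomputable def invertOn {g : ℕ} (b : Fin g → ℂ) (T : Finset (Fin g)) (i : Fin g) : ℂ :=
  if i ∈ T then (b i)⁻¹ else b i

lemma invertOn_injective {g : ℕ} {b : Fin g → ℂ} (hinj : Function.Injective b)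
    (hinv : ∀ i j, b i ≠ (b j)⁻¹) (T : Finset (Fin g)) : Function.Injective (invertOn b T) := by
  intro i j h
  unfold invertOn at h
  split_ifs at h
  · exact hinj (inv_injective h)
  · exact absurd h.symm (hinv j i)
  · exact absurd h (hinv i j)
  · exact hinj h

lemma sub_mul_inv_sub_inv_ne {x y : ℂ} (hx : x ≠ 0) (hy : y ≠ 0) (hx' : x ≠ x⁻¹)
    (hy' : y ≠ y⁻¹) : (x - y) * (x⁻¹ - y⁻¹) ≠ (x⁻¹ - y) * (x - y⁻¹) := by
  intro h
  field_simp at h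
  have hx₂ : x ^ 2 - 1 ≠ 0 := fun h => hx' (by field_simp; linear_combination h)
  have hy₂ : y ^ 2 - 1 ≠ 0 := fun h => hy' (by field_simp; linear_combination h)
  exact mul_ne_zero hx₂ hy₂ (by linear_combination h)

lemma Hfun_invertOn_mul_ne_of_lt {g : ℕ} {b : Fin g → ℂ} (h₀ : ∀ i, b i ≠ 0)
    (hinj : Function.Injective b) (hinv : ∀ i j, b i ≠ (b j)⁻¹) {i j : Fin g} (hij : i < j) :
    Hfun (invertOn b ∅) * Hfun (invertOn b {i, j}) ≠
      Hfun (invertOn b {i}) * Hfun (invertOn b {j}) := by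
  have hmem : (i, j) ∈ Finset.univ.filter fun p : Fin g × Fin g => p.1 < p.2 := by simpa using hij
  have ne_zero (T : Finset (Fin g)) : ∏ p ∈ (Finset.univ.filter
      fun p : Fin g × Fin g => p.1 < p.2).erase (i, j),
        (invertOn b T p.1 - invertOn b T p.2) ≠ 0 := by
    refine Finset.prod_ne_zero_iff.2 fun p hp => sub_ne_zero.2 ?_
    simp only [Finset.mem_erase, Finset.mem_filter] at hp
    exact (invertOn_injective hinj hinv T).ne hp.2.2.ne
  have rest : ∏ p ∈ (Finset.univ.filter fun p : Fin g × Fin g => p.1 < p.2).erase (i, j),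
        ((invertOn b ∅ p.1 - invertOn b ∅ p.2) *
          (invertOn b {i, j} p.1 - invertOn b {i, j} p.2)) =
      ∏ p ∈ (Finset.univ.filter fun p : Fin g × Fin g => p.1 < p.2).erase (i, j),
        ((invertOn b {i} p.1 - invertOn b {i} p.2) *
          (invertOn b {j} p.1 - invertOn b {j} p.2)) := by
    refine Finset.prod_congr rfl fun p hp => ?_
    obtain ⟨k, l⟩ := p
    simp only [Finset.mem_erase, Finset.mem_filter, ne_eq, Prod.mk.injEq] at hp
    simp only [invertOn, Finset.mem_insert, Finset.mem_singleton, Finset.notMem_empty, if_false]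
    by_cases hki : k = i <;> by_cases hkj : k = j <;> by_cases hli : l = i <;>
      by_cases hlj : l = j <;> grind
  simp only [Finset.prod_mul_distrib] at rest
  simp only [Hfun_eq_prod_pairs, ← Finset.mul_prod_erase _ _ hmem]
  intro h
  refine sub_mul_inv_sub_inv_ne (h₀ i) (h₀ j) (hinv i i) (hinv j j) ?_
  refine mul_right_cancel₀ (mul_ne_zero (ne_zero ∅) (ne_zero {i, j})) ?_
  have hi : i ≠ j := hij.ne
  simp only [invertOn, Finset.mem_insert, Finset.mem_singleton, Finset.notMem_empty, if_false,
    hi, hi.symm, or_false, or_true, if_true] at h rest ⊢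
  linear_combination h - ((b i)⁻¹ - b j) * (b i - (b j)⁻¹) * rest

lemma Hfun_invertOn_mul_ne {g : ℕ} {b : Fin g → ℂ} (h₀ : ∀ i, b i ≠ 0)
    (hinj : Function.Injective b) (hinv : ∀ i j, b i ≠ (b j)⁻¹) {i j : Fin g} (hij : i ≠ j) :
    Hfun (invertOn b ∅) * Hfun (invertOn b {i, j}) ≠
      Hfun (invertOn b {i}) * Hfun (invertOn b {j}) := by
  rcases hij.lt_or_gt with h | h
  · exact Hfun_invertOn_mul_ne_of_lt h₀ hinj hinv h
  · rw [Finset.pair_comm, mul_comm (Hfun (invertOn b {i}))]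
    exact Hfun_invertOn_mul_ne_of_lt h₀ hinj hinv h

theorem stmt1 (g : ℕ) (hg : 1 ≤ g) (ρ β b : Fin g → ℂ)
    (hρdist : Function.Injective ρ) (hρ1 : ∀ i, ρ i ≠ 1 ∧ ρ i ≠ -1)
    (hβ : ∀ i, β i ^ 2 = ρ i ^ 2 - 1) (hbdef : ∀ i, b i = ρ i + β i)
    (hbinj : Function.Injective b) (hbInv : ∀ i j, b i ≠ (b j)⁻¹) :
    Irreducible (Fpoly b) := by
  have h₀ (i : Fin g) : b i ≠ 0 := by
    intro h
    have h' := hβ i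
    rw [show β i = -ρ i by linear_combination h - hbdef i] at h'
    exact one_ne_zero (by linear_combination h' : (1 : ℂ) = 0)
  have : Nonempty (Fin g) := ⟨⟨0, hg⟩⟩
  refine MvPolynomial.irreducible_sum_C_mul_prod_X
    (fun T => (-1 : ℂ) ^ T.card * Hfun (invertOn b T)) ?_ (fun i => ?_) (fun i j hij => ?_)
  · exact mul_ne_zero (by simp) (Hfun_ne_zero (invertOn_injective hbinj hbInv _))
  · exact mul_ne_zero (by simp) (Hfun_ne_zero (invertOn_injective hbinj hbInv _))
  · simpa [Finset.card_pair hij] using Hfun_invertOn_mul_ne h₀ hbinj hbInv hij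
end

section
/- Let n, m ≥ 1 be integers and let p ∈ ℂ[x_1, …, x_n] be a polynomial whose degree in each variable x_i is at most m. Let S ⊆ ℂ be a set with at least m + n elements. If p(u_1, …, u_n) = 0 for every choice of pairwise distinct elements u_1, …, u_n ∈ S, then p is the zero polynomial. -/
/-- A polynomial of degree at most `m` in each of its `n` variables that vanishes at all injective
tuples of elements of a set of size at least `m + n` is zero. -/
theorem MvPolynomial.eq_zero_of_eval_injective_eq_zero {R : Type*} [CommRing R] [IsDomain R]
    {n m : ℕ} (p : MvPolynomial (Fin n) R) (hdeg : ∀ i, p.degreeOf i ≤ m)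
    (T : Finset R) (hT : m + n ≤ T.card)
    (hvan : ∀ u : Fin n → R, Function.Injective u → (∀ i, u i ∈ T) → eval u p = 0) :
    p = 0 := by
  classical
  induction n with
  | zero =>
    obtain ⟨c, rfl⟩ := C_surjective (Fin 0) p
    simpa using hvan Fin.elim0 (fun i => i.elim0) (fun i => i.elim0)
  | succ n ih =>
    suffices h : finSuccEquiv R n p = 0 from (finSuccEquiv R n).map_eq_zero_iff.mp h
    ext1 k
    rw [Polynomial.coeff_zero]
    refine ih _ (fun j => (degreeOf_coeff_finSuccEquiv p j k).trans (hdeg _)) (by lia) ?_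
    intro s hs hsT
    have hzero : (finSuccEquiv R n p).map (eval s) = 0 := by
      refine Polynomial.eq_zero_of_natDegree_lt_card_of_eval_eq_zero' _
        (T \ Finset.univ.image s) (fun y hy => ?_) ?_
      · rw [Finset.mem_sdiff] at hy
        rw [← eval_eq_eval_mv_eval']
        refine hvan _ (Fin.cons_injective_iff.mpr ⟨by simpa using hy.2, hs⟩) ?_
        exact Fin.cases hy.1 hsT
      · have hcard : (Finset.univ.image s).card = n := by
          simp [Finset.card_image_of_injective _ hs]
        have hsdiff := Finset.le_card_sdiff (Finset.univ.image s) T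
        have hnat : ((finSuccEquiv R n p).map (eval s)).natDegree ≤ m :=
          Polynomial.natDegree_map_le.trans ((natDegree_finSuccEquiv p).trans_le (hdeg 0))
        lia
    rw [← Polynomial.coeff_map, hzero, Polynomial.coeff_zero]

theorem stmt2 (n m : ℕ) (hn : 1 ≤ n) (hm : 1 ≤ m)
    (p : MvPolynomial (Fin n) ℂ)
    (hdeg : ∀ i : Fin n, MvPolynomial.degreeOf i p ≤ m)
    (S : Set ℂ) (hS : ((m + n : ℕ) : Cardinal) ≤ Cardinal.mk S)
    (hvan : ∀ u : Fin n → ℂ, Function.Injective u → (∀ i, u i ∈ S) →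
      MvPolynomial.eval u p = 0) :
    p = 0 := by
  obtain ⟨T, hT⟩ := Cardinal.exists_finset_le_card S (m + n) hS
  refine p.eq_zero_of_eval_injective_eq_zero hdeg (T.map (Function.Embedding.subtype _))
    (by simpa using hT) (fun u hu huT => hvan u hu fun i => ?_)
  obtain ⟨x, -, hx⟩ := Finset.mem_map.mp (huT i)
  exact hx ▸ x.2
end

section
/- The polynomial p(z_1, …, z_{g−1}) = Σ_{A ∈ {0,1}^g} (−1)^a H(b_1^{1−2a_1}, …, b_g^{1−2a_g}) ∏_{i=1}^g ∏_{j=1}^{g−1} (z_j − b_i^{2a_i−1}) is identically zero in ℂ[z_1, …, z_{g−1}]; consequently, for all z_1, …, z_{g−1} ∈ ℂ ∖ {b_1^{±1}, …, b_g^{±1}} one has F(∏_{j=1}^{g−1} r_1(z_j), …, ∏_{j=1}^{g−1} r_g(z_j)) = 0, i.e. W_{g−1} is contained in the zero locus of F. -/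
/-- `p(z_1, …, z_{g−1}) = Σ_{A} (−1)^a H(b_1^{1−2a_1}, …, b_g^{1−2a_g})
∏_{i=1}^g ∏_{j=1}^{g−1} (z_j − b_i^{2a_i−1})`. -/
noncomputable def Ppoly {g : ℕ} (b : Fin g → ℂ) : MvPolynomial (Fin (g - 1)) ℂ :=
  ∑ T : Finset (Fin g),
    MvPolynomial.C ((-1 : ℂ) ^ T.card * Hfun (fun i => if i ∈ T then (b i)⁻¹ else b i)) *
      ∏ i : Fin g, ∏ j : Fin (g - 1),
        (MvPolynomial.X j - MvPolynomial.C (if i ∈ T then b i else (b i)⁻¹))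

theorem Hfun_eq_det_vandermonde_neg {g : ℕ} (u : Fin g → ℂ) :
    Hfun u = (Matrix.vandermonde (-u)).det := by
  simp only [Hfun, Matrix.det_vandermonde, Pi.neg_apply, neg_sub_neg]

/-- Multilinear expansion of the determinant whose `i`-th row is the difference of the
scaled Vandermonde rows `s i • (-v i) ^ k - t i • (-w i) ^ k`. -/
theorem sum_Hfun_mul_prod_eq_det {g : ℕ} (v w s t : Fin g → ℂ) :
    ∑ T : Finset (Fin g), (-1 : ℂ) ^ T.card * Hfun (fun i => if i ∈ T then w i else v i) *
        ∏ i, (if i ∈ T then t i else s i) =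
      (Matrix.of fun i k : Fin g => s i * (-v i) ^ (k : ℕ) - t i * (-w i) ^ (k : ℕ)).det := by
  have hrows : (Matrix.of fun i k : Fin g => s i * (-v i) ^ (k : ℕ) - t i * (-w i) ^ (k : ℕ)) =
      (fun i k : Fin g => -t i * (-w i) ^ (k : ℕ)) +
        (fun i k : Fin g => s i * (-v i) ^ (k : ℕ)) := by
    ext i k
    simp only [Matrix.of_apply, Pi.add_apply]
    ring
  have hexp := (Matrix.detRowAlternating (R := ℂ) (n := Fin g)).toMultilinearMap.map_add_univ
    (fun i k : Fin g => -t i * (-w i) ^ (k : ℕ)) (fun i k : Fin g => s i * (-v i) ^ (k : ℕ))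
  rw [hrows]
  refine Eq.trans ?_ hexp.symm
  refine Finset.sum_congr rfl fun T _ => ?_
  have hT : T.piecewise (fun i k : Fin g => -t i * (-w i) ^ (k : ℕ))
      (fun i k : Fin g => s i * (-v i) ^ (k : ℕ)) =
      Matrix.of fun i k : Fin g => (if i ∈ T then -t i else s i) *
        Matrix.vandermonde (-fun i => if i ∈ T then w i else v i) i k := by
    ext i k
    by_cases h : i ∈ T <;> simp [h, Matrix.vandermonde_apply]
  have hprod : ∏ i, (if i ∈ T then -t i else s i) =
      (-1) ^ T.card * ∏ i, (if i ∈ T then t i else s i) := by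
    simp [Finset.prod_ite, Finset.prod_neg]
    ring
  change _ = Matrix.det (T.piecewise _ _)
  rw [hT, Matrix.det_mul_column, hprod, Hfun_eq_det_vandermonde_neg]
  ring

theorem sum_Hfun_inv_mul_prod_eq_zero {g : ℕ} (hg : 1 ≤ g) (b : Fin g → ℂ)
    (z : Fin (g - 1) → ℂ) :
    ∑ T : Finset (Fin g), (-1 : ℂ) ^ T.card * Hfun (fun i => if i ∈ T then (b i)⁻¹ else b i) *
        ∏ i, ∏ j, (z j - if i ∈ T then b i else (b i)⁻¹) = 0 := by
  let q : Polynomial ℂ := ∏ j, (Polynomial.X + Polynomial.C (z j))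
  have hmonic : q.Monic := Polynomial.monic_prod_of_monic _ _ fun j _ => Polynomial.monic_X_add_C _
  have hdeg : q.natDegree = g - 1 := by
    simp [q, Polynomial.natDegree_prod_of_monic _ _ fun j _ => Polynomial.monic_X_add_C _]
  have heval (x : ℂ) : ∑ k : Fin g, (-x) ^ (k : ℕ) * q.coeff k = ∏ j, (z j - x) := by
    have h := Polynomial.eval_eq_sum_range' (show q.natDegree < g by omega) (-x)
    rw [← Fin.sum_univ_eq_sum_range (fun k => q.coeff k * (-x) ^ k)] at h
    simp only [mul_comm _ (q.coeff _), ← h, q, Polynomial.eval_prod, Polynomial.eval_add,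
      Polynomial.eval_X, Polynomial.eval_C, neg_add_eq_sub]
  have hterm (T : Finset (Fin g)) (i : Fin g) :
      ∏ j, (z j - if i ∈ T then b i else (b i)⁻¹) =
        if i ∈ T then ∏ j, (z j - b i) else ∏ j, (z j - (b i)⁻¹) := by
    split_ifs <;> rfl
  simp only [hterm]
  rw [sum_Hfun_mul_prod_eq_det]
  refine Matrix.exists_mulVec_eq_zero_iff.mp ⟨fun k => q.coeff k, fun h => ?_, ?_⟩
  · have hlead : q.coeff (g - 1) = 0 := congrFun h ⟨g - 1, by omega⟩
    rw [← hdeg, hmonic.coeff_natDegree] at hlead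
    exact one_ne_zero hlead
  · ext i
    simp only [Matrix.mulVec, dotProduct, Matrix.of_apply, sub_mul, mul_assoc,
      Finset.sum_sub_distrib, ← Finset.mul_sum, heval, Pi.zero_apply]
    ring

theorem stmt3 (g : ℕ) (hg : 1 ≤ g) (ρ β b : Fin g → ℂ)
    (hρdist : Function.Injective ρ) (hρ1 : ∀ i, ρ i ≠ 1 ∧ ρ i ≠ -1)
    (hβ : ∀ i, β i ^ 2 = ρ i ^ 2 - 1) (hbdef : ∀ i, b i = ρ i + β i)
    (hbinj : Function.Injective b) (hbInv : ∀ i j, b i ≠ (b j)⁻¹) :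
    Ppoly b = 0 ∧
      ∀ z : Fin (g - 1) → ℂ, (∀ j i, z j ≠ b i ∧ z j ≠ (b i)⁻¹) →
        MvPolynomial.eval (fun i => ∏ j, (z j - b i) / (z j - (b i)⁻¹)) (Fpoly b) = 0 := by
  refine ⟨MvPolynomial.funext fun z => ?_, fun z hz => ?_⟩
  · simpa [Ppoly] using sum_Hfun_inv_mul_prod_eq_zero hg b z
  · have hne : ∏ i, ∏ j, (z j - (b i)⁻¹) ≠ 0 :=
      Finset.prod_ne_zero_iff.mpr fun i _ => Finset.prod_ne_zero_iff.mpr fun j _ =>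
        sub_ne_zero.mpr (hz j i).2
    refine (mul_eq_zero.mp ?_).resolve_right hne
    rw [← sum_Hfun_inv_mul_prod_eq_zero hg b z]
    simp only [Fpoly, map_sum, map_mul, map_prod, MvPolynomial.eval_C, MvPolynomial.eval_X,
      Finset.sum_mul, mul_assoc]
    refine Finset.sum_congr rfl fun T _ => ?_
    congr 2
    rw [← Fintype.prod_ite_mem T, ← Finset.prod_mul_distrib]
    refine Finset.prod_congr rfl fun i _ => ?_
    split_ifs
    · rw [← Finset.prod_mul_distrib]
      exact Finset.prod_congr rfl fun j _ => div_mul_cancel₀ _ (sub_ne_zero.mpr (hz j i).2)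
    · rw [one_mul]
end

section
/- The Zariski closure of W_{g−1} in affine g-space over ℂ is exactly the hypersurface {x ∈ ℂ^g : F(x) = 0}; that is, the zero locus in ℂ^g of the vanishing ideal of the set W_{g−1} equals the zero locus of the single polynomial F. -/
/-- A point of `ℂ ∪ {∞}` avoids all the `b_i^{±1}`. -/
def Allowed {g : ℕ} (b : Fin g → ℂ) (w : Option ℂ) : Prop :=
  ∀ i, w ≠ some (b i) ∧ w ≠ some (b i)⁻¹

/-- `W_l`: the set of points `(∏_j r_1(z_j), …, ∏_j r_g(z_j))` with the `z_j` ranging over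
`(ℂ ∪ {∞}) ∖ {b_1^{±1}, …, b_g^{±1}}`. -/
def Wn {g : ℕ} (b : Fin g → ℂ) (l : ℕ) : Set (Fin g → ℂ) :=
  {x | ∃ z : Fin l → Option ℂ, (∀ j, Allowed b (z j)) ∧ ∀ i, x i = ∏ j, rr (b i) (z j)}

theorem list_prod_map_eq_prod_getElem? {α M : Type*} [CommMonoid M] (f : Option α → M)
    (hf : f none = 1) (l : List α) {n : ℕ} (hn : l.length ≤ n) :
    ∏ j : Fin n, f l[(j : ℕ)]? = (l.map fun a => f (some a)).prod := by
  induction l generalizing n with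
  | nil => simp [hf]
  | cons a l ih =>
    obtain ⟨m, rfl⟩ : ∃ m, n = m + 1 := ⟨n - 1, by simp at hn; omega⟩
    simp only [List.length_cons, add_le_add_iff_right] at hn
    simp [Fin.prod_univ_succ, ih hn]

open Polynomial in
/-- The values `Q(b_i) / Q(b_i⁻¹)` of a polynomial of degree at most `l` form a point of `W_l`. -/
theorem eval_div_eval_mem_Wn {g l : ℕ} {b : Fin g → ℂ} {Q : ℂ[X]} (hQ : Q.natDegree ≤ l)
    (h : ∀ i, Q.eval (b i) ≠ 0) (h' : ∀ i, Q.eval (b i)⁻¹ ≠ 0) :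
    (fun i => Q.eval (b i) / Q.eval (b i)⁻¹) ∈ Wn b l := by
  refine ⟨fun j => Q.roots.toList[(j : ℕ)]?, fun j i => ⟨fun hj => h i ?_, fun hj => h' i ?_⟩,
    fun i => ?_⟩
  · exact (mem_roots'.1 (Multiset.mem_toList.1 (List.mem_of_getElem? hj))).2
  · exact (mem_roots'.1 (Multiset.mem_toList.1 (List.mem_of_getElem? hj))).2
  · rw [list_prod_map_eq_prod_getElem? (rr (b i)) rfl _
      (by simpa using (card_roots' Q).trans hQ)]
    have hQ0 : Q.leadingCoeff ≠ 0 := by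
      rw [leadingCoeff_ne_zero]
      rintro rfl
      simpa using h i
    have key : ∀ t, Q.eval t = Q.leadingCoeff * (Q.roots.toList.map fun z => t - z).prod := by
      intro t
      rw [(IsAlgClosed.splits Q).eval_eq_prod_roots, ← Multiset.prod_coe, ← Multiset.map_coe,
        Multiset.coe_toList]
    simp only [key]
    rw [mul_div_mul_left _ _ hQ0]
    induction Q.roots.toList with
    | nil => simp
    | cons z l ih =>
      simp only [List.map_cons, List.prod_cons, ← ih, mul_div_mul_comm]
      rw [← neg_sub z, ← neg_sub z, neg_div_neg_eq, rr, Option.elim_some]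

theorem Hfun_eq_mul_det_vandermonde {g : ℕ} (u : Fin g → ℂ) :
    Hfun u = (∏ i : Fin g, ∏ _j ∈ Finset.Ioi i, (-1 : ℂ)) * (Matrix.vandermonde u).det := by
  simp [Hfun, Matrix.det_vandermonde, ← Finset.prod_mul_distrib, -Finset.prod_const]

theorem eval_Fpoly {g : ℕ} (b x : Fin g → ℂ) :
    MvPolynomial.eval x (Fpoly b) = (∏ i : Fin g, ∏ _j ∈ Finset.Ioi i, (-1 : ℂ)) *
      (Matrix.of fun i (k : Fin g) => b i ^ (k : ℕ) - x i * (b i)⁻¹ ^ (k : ℕ)).det := by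
  have hdet : (Matrix.of fun i (k : Fin g) => b i ^ (k : ℕ) - x i * (b i)⁻¹ ^ (k : ℕ)) =
      Matrix.of (fun i (k : Fin g) => -x i * (b i)⁻¹ ^ (k : ℕ)) +
        Matrix.of fun i (k : Fin g) => b i ^ (k : ℕ) := by
    ext i k
    simp
    ring
  have hexpand (m m' : Matrix (Fin g) (Fin g) ℂ) :
      (m + m').det = ∑ T : Finset (Fin g), Matrix.det (T.piecewise m m') :=
    Matrix.detRowAlternating.toMultilinearMap.map_add_univ m m'
  rw [hdet, hexpand, Finset.mul_sum, Fpoly, map_sum]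
  refine Finset.sum_congr rfl fun T _ => ?_
  have hT : T.piecewise (Matrix.of fun i (k : Fin g) => -x i * (b i)⁻¹ ^ (k : ℕ))
      (Matrix.of fun i (k : Fin g) => b i ^ (k : ℕ)) = Matrix.of fun i k => (if i ∈ T then -x i else 1) *
        Matrix.vandermonde (fun i => if i ∈ T then (b i)⁻¹ else b i) i k := by
    ext i k
    change (if i ∈ T then _ else _ : Fin g → ℂ) k = _
    by_cases h : i ∈ T <;> simp [h, Matrix.vandermonde_apply]
  rw [hT, Matrix.det_mul_column,
    Hfun_eq_mul_det_vandermonde, Finset.prod_ite_mem, Finset.univ_inter, Finset.prod_neg]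
  simp only [map_mul, MvPolynomial.eval_C, map_prod, MvPolynomial.eval_X]
  ring

open Polynomial in
theorem eval_Fpoly_eq_zero_iff {g : ℕ} (b x : Fin g → ℂ) :
    MvPolynomial.eval x (Fpoly b) = 0 ↔
      ∃ P : ℂ[X], P ≠ 0 ∧ P.degree < g ∧ ∀ i, P.eval (b i) = x i * P.eval (b i)⁻¹ := by
  have hsign : (∏ i : Fin g, ∏ _j ∈ Finset.Ioi i, (-1 : ℂ)) ≠ 0 :=
    Finset.prod_ne_zero_iff.2 fun i _ => Finset.prod_ne_zero_iff.2 fun j _ => by simp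
  rw [eval_Fpoly, mul_eq_zero, or_iff_right hsign, ← Matrix.exists_mulVec_eq_zero_iff]
  have key : ∀ P : degreeLT ℂ g, ∀ i, ((Matrix.of fun i (k : Fin g) =>
      b i ^ (k : ℕ) - x i * (b i)⁻¹ ^ (k : ℕ)).mulVec (degreeLTEquiv ℂ g P)) i =
      (P : ℂ[X]).eval (b i) - x i * (P : ℂ[X]).eval (b i)⁻¹ := by
    intro P i
    rw [eval_eq_sum_degreeLTEquiv P.2, eval_eq_sum_degreeLTEquiv P.2, Finset.mul_sum,
      ← Finset.sum_sub_distrib, Matrix.mulVec, dotProduct]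
    refine Finset.sum_congr rfl fun k _ => ?_
    simp only [Matrix.of_apply, Subtype.coe_eta]
    ring
  constructor
  · rintro ⟨c, hc, hc0⟩
    obtain ⟨P, rfl⟩ := (degreeLTEquiv ℂ g).surjective c
    refine ⟨P, fun h => hc ?_, mem_degreeLT.1 P.2, fun i => ?_⟩
    · rw [Subtype.ext h (a2 := (0 : degreeLT ℂ g)), map_zero]
    · rw [← sub_eq_zero, ← key P i, hc0, Pi.zero_apply]
  · rintro ⟨P, hP, hdeg, h⟩
    refine ⟨degreeLTEquiv ℂ g ⟨P, mem_degreeLT.2 hdeg⟩, fun h0 => hP ?_, funext fun i => ?_⟩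
    · simpa using h0
    · rw [key, h i, sub_self, Pi.zero_apply]

open Polynomial in
theorem eval_Fpoly_eq_zero_of_mem_Wn {g : ℕ} (hg : 1 ≤ g) {b x : Fin g → ℂ}
    (hx : x ∈ Wn b (g - 1)) : MvPolynomial.eval x (Fpoly b) = 0 := by
  obtain ⟨z, hz, hx⟩ := hx
  rw [eval_Fpoly_eq_zero_iff]
  refine ⟨∏ j, (z j).elim 1 fun w => X - C w, ?_, ?_, fun i => ?_⟩
  · refine Finset.prod_ne_zero_iff.2 fun j _ => ?_
    cases z j with
    | none => simp
    | some w => simpa using X_sub_C_ne_zero w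
  · rw [degree_prod]
    calc _ ≤ ∑ _j : Fin (g - 1), (1 : WithBot ℕ) := Finset.sum_le_sum fun j _ => by
          cases z j with
          | none => simp
          | some w => simp
      _ < g := by
          simp only [Finset.sum_const, Finset.card_univ, Fintype.card_fin, nsmul_one]
          exact_mod_cast Nat.sub_one_lt_of_le hg le_rfl
  · rw [hx, eval_prod, eval_prod, ← Finset.prod_mul_distrib]
    refine Finset.prod_congr rfl fun j _ => ?_
    have hj := (hz j i).2
    cases hzj : z j with
    | none => simp [rr]
    | some w =>
      have hw : w - (b i)⁻¹ ≠ 0 := sub_ne_zero.2 fun h => hj (by rw [hzj, h])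
      simp only [rr, Option.elim_some, eval_sub, eval_X, eval_C]
      rw [← neg_sub w (b i), ← neg_sub w (b i)⁻¹, mul_neg, div_mul_cancel₀ _ hw]

open Filter Topology in
theorem eventually_add_mul_add_sq_ne_zero (α γ : ℂ) :
    ∀ᶠ t in 𝓝[≠] (0 : ℂ), α + t * γ + t ^ 2 ≠ 0 := by
  have hq : (Polynomial.X ^ 2 + Polynomial.C γ * Polynomial.X + Polynomial.C α) ≠ 0 := by
    intro h
    simpa using congrArg (Polynomial.coeff · 2) h
  have hfin := (Polynomial.finite_setOfPred_isRoot hq).eventually_cofinite_notMem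
  filter_upwards [nhdsNE_le_cofinite 0 hfin] with t ht h
  refine ht ?_
  simp only [Polynomial.IsRoot, Polynomial.eval_add, Polynomial.eval_mul,
    Polynomial.eval_pow, Polynomial.eval_X, Polynomial.eval_C]
  linear_combination h

open Polynomial Filter Topology in
/-- Every zero of `F` is a limit, in the Euclidean topology, of points of `W_{g-1}`. -/
theorem mem_closure_Wn {g : ℕ} {b x : Fin g → ℂ} (hbinj : Function.Injective b)
    (hbInv : ∀ i j, b i ≠ (b j)⁻¹) (hx : MvPolynomial.eval x (Fpoly b) = 0) :
    x ∈ closure (Wn b (g - 1)) := by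
  classical
  obtain ⟨P, hP, hdeg, hPx⟩ := (eval_Fpoly_eq_zero_iff b x).1 hx
  set S : Finset (Fin g) := {i | P.eval (b i)⁻¹ = 0} with hS
  have hmem : ∀ i, i ∈ S ↔ P.eval (b i)⁻¹ = 0 := fun i => by simp [hS]
  set v : Fin g ⊕ Fin g → ℂ := Sum.elim b fun i => (b i)⁻¹ with hv
  have hinj : Function.Injective v :=
    hbinj.sumElim (inv_injective.comp hbinj) hbInv
  have hcard : ((S.disjSum S).card : WithBot ℕ) ≤ P.degree := by
    by_contra! hlt
    refine hP (eq_zero_of_degree_lt_of_eval_index_eq_zero (S.disjSum S) hinj.injOn hlt ?_)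
    rintro (i | i) hi
    · have hi' := (hmem i).1 (by simpa using hi)
      simp [hv, hPx, hi']
    · exact (hmem i).1 (by simpa using hi)
  -- `R` interpolates the prescribed ratios at the indices where `P` carries no information.
  set R := Lagrange.interpolate (S.disjSum S) v (Sum.elim x 1) with hR
  have hRdeg : R.degree < g :=
    (Lagrange.degree_interpolate_lt _ hinj.injOn).trans (hcard.trans_lt hdeg)
  have hRb : ∀ i ∈ S, R.eval (b i) = x i := fun i hi =>
    Lagrange.eval_interpolate_at_node (i := Sum.inl i) (Sum.elim x 1) hinj.injOn (by simpa using hi)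
  have hRb' : ∀ i ∈ S, R.eval (b i)⁻¹ = 1 := fun i hi =>
    Lagrange.eval_interpolate_at_node (i := Sum.inr i) (Sum.elim x 1) hinj.injOn (by simpa using hi)
  set Q : ℂ → ℂ[X] := fun t => P + C t * R + C (t ^ 2) with hQ
  have hQeval : ∀ t s, (Q t).eval s = P.eval s + t * R.eval s + t ^ 2 := by simp [hQ]
  have hQdeg : ∀ t, (Q t).natDegree ≤ g - 1 := by
    intro t
    have h1 : P.natDegree ≤ g - 1 := Nat.le_sub_one_of_lt ((natDegree_lt_iff_degree_lt hP).2 hdeg)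
    have h2 : R.natDegree ≤ g - 1 := by
      by_cases h0 : R = 0
      · simp [h0]
      · exact Nat.le_sub_one_of_lt ((natDegree_lt_iff_degree_lt h0).2 hRdeg)
    exact natDegree_add_le_of_degree_le (natDegree_add_le_of_degree_le h1
      ((natDegree_C_mul_le _ _).trans h2)) (by simp)
  have hW : ∀ᶠ t in 𝓝[≠] (0 : ℂ),
      (fun i => (Q t).eval (b i) / (Q t).eval (b i)⁻¹) ∈ Wn b (g - 1) := by
    filter_upwards [eventually_all.2 fun i =>
        eventually_add_mul_add_sq_ne_zero (P.eval (b i)) (R.eval (b i)),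
      eventually_all.2 fun i =>
        eventually_add_mul_add_sq_ne_zero (P.eval (b i)⁻¹) (R.eval (b i)⁻¹)] with t h h'
    exact eval_div_eval_mem_Wn (hQdeg t) (fun i => by rw [hQeval]; exact h i)
      (fun i => by rw [hQeval]; exact h' i)
  refine mem_closure_of_tendsto (tendsto_pi_nhds.2 fun i => ?_) hW
  by_cases hi : i ∈ S
  · have hlim : Tendsto (fun t : ℂ => (x i + t) / (1 + t)) (𝓝[≠] 0) (𝓝 (x i)) := by
      have : ContinuousAt (fun t : ℂ => (x i + t) / (1 + t)) 0 :=
        ContinuousAt.div (by fun_prop) (by fun_prop) (by simp)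
      simpa using this.tendsto.mono_left nhdsWithin_le_nhds
    refine hlim.congr' ?_
    filter_upwards [self_mem_nhdsWithin] with t ht
    have hi' := (hmem i).1 hi
    rw [hQeval, hQeval, hRb i hi, hRb' i hi, hPx, hi', ← mul_div_mul_left _ _ ht]
    ring
  · have hi' := mt (hmem i).2 hi
    have : ContinuousAt (fun t : ℂ => (Q t).eval (b i) / (Q t).eval (b i)⁻¹) 0 := by
      simp only [hQeval]
      exact ContinuousAt.div (by fun_prop) (by fun_prop) (by simpa using hi')
    have hlim := this.tendsto.mono_left (nhdsWithin_le_nhds (s := {0}ᶜ))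
    rwa [hQeval, hQeval, hPx, zero_mul, zero_mul, zero_pow two_ne_zero, add_zero, add_zero,
      add_zero, add_zero, mul_div_cancel_right₀ _ hi'] at hlim

/-- The Zariski closure of `W_{g-1}` (zero locus of its vanishing ideal) is exactly the
hypersurface `F = 0`. -/
theorem stmt4 (g : ℕ) (hg : 1 ≤ g) (ρ β b : Fin g → ℂ)
    (hρdist : Function.Injective ρ) (hρ1 : ∀ i, ρ i ≠ 1 ∧ ρ i ≠ -1)
    (hβ : ∀ i, β i ^ 2 = ρ i ^ 2 - 1) (hbdef : ∀ i, b i = ρ i + β i)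
    (hbinj : Function.Injective b) (hbInv : ∀ i j, b i ≠ (b j)⁻¹) :
    {x : Fin g → ℂ | ∀ p : MvPolynomial (Fin g) ℂ,
        (∀ y ∈ Wn b (g - 1), MvPolynomial.eval y p = 0) → MvPolynomial.eval x p = 0} =
      {x : Fin g → ℂ | MvPolynomial.eval x (Fpoly b) = 0} := by
  ext x
  refine ⟨fun h => h _ fun y hy => eval_Fpoly_eq_zero_of_mem_Wn hg hy, fun hx p hp => ?_⟩
  have hclosed : IsClosed {y : Fin g → ℂ | MvPolynomial.eval y p = 0} :=
    isClosed_eq (MvPolynomial.continuous_eval p) continuous_const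
  exact closure_minimal hp hclosed (mem_closure_Wn hbinj hbInv hx)
end

section
/- For every 0 ≤ l ≤ g, the closure of W_l in (ℂ^×)^g equals the union of W_l and δ · ⋃_{j=1}^g π_j^{−1}( closure of W^{(j)}_{l−2} ), where δ · X denotes coordinatewise multiplication of the set X by δ. (For l ≤ 1 the second term is empty, so W_0 and W_1 are closed.) -/
/-- `W_l` for an integer `l` (empty for negative `l`). -/
def W {g : ℕ} (b : Fin g → ℂ) (l : ℤ) : Set (Fin g → ℂ) :=
  {x | ∃ m : ℕ, (m : ℤ) = l ∧ x ∈ Wn b m}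

/-- The torus `(ℂ^×)^g` inside `ℂ^g`. -/
def Torus (g : ℕ) : Set (Fin g → ℂ) := {x | ∀ i, x i ≠ 0}

/-- Closure taken inside the torus `(ℂ^×)^g` (Euclidean topology). -/
noncomputable def closT {g : ℕ} (S : Set (Fin g → ℂ)) : Set (Fin g → ℂ) :=
  closure S ∩ Torus g

/-- The increasing map `Fin (g-1) → Fin g` skipping the index `j`. -/
def skip {g : ℕ} (j : Fin g) (i : Fin (g - 1)) : Fin g :=
  if (i : ℕ) < (j : ℕ) then ⟨i, by have := i.2; omega⟩
  else ⟨(i : ℕ) + 1, by have := i.2; omega⟩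

open Polynomial in
/-- Coordinates of points of `W_l` are the ratios `P(b_i) / P(b_i⁻¹)`, `deg P ≤ l`. -/
theorem exists_poly_of_mem_Wn {g : ℕ} {b : Fin g → ℂ} {l : ℕ} {x : Fin g → ℂ}
    (hx : x ∈ Wn b l) :
    ∃ P : ℂ[X], P ≠ 0 ∧ P.natDegree ≤ l ∧
      ∀ i, P.eval (b i) ≠ 0 ∧ P.eval (b i)⁻¹ ≠ 0 ∧ P.eval (b i) = x i * P.eval (b i)⁻¹ := by
  obtain ⟨z, hz, hxz⟩ := hx
  have hne : ∀ j i, (Option.elim (z j) 1 (fun w => X - C w) : ℂ[X]).eval (b i) ≠ 0 ∧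
      (Option.elim (z j) 1 (fun w => X - C w) : ℂ[X]).eval (b i)⁻¹ ≠ 0 := by
    intro j i
    have h := hz j i
    rcases hj : z j with _ | w
    · simp
    · rw [hj] at h
      simp only [ne_eq, Option.some.injEq] at h
      simpa [sub_eq_zero, eq_comm] using h
  refine ⟨∏ j, Option.elim (z j) 1 (fun w => X - C w), ?_, ?_, fun i => ⟨?_, ?_, ?_⟩⟩
  · refine Finset.prod_ne_zero_iff.2 fun j _ => ?_
    rcases z j with _ | w
    · exact one_ne_zero
    · exact X_sub_C_ne_zero w
  · refine (natDegree_prod_le _ _).trans ((Finset.sum_le_card_nsmul _ _ 1 fun j _ => ?_).trans ?_)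
    · rcases z j with _ | w <;> simp
    · simp
  · rw [eval_prod]
    exact Finset.prod_ne_zero_iff.2 fun j _ => (hne j i).1
  · rw [eval_prod]
    exact Finset.prod_ne_zero_iff.2 fun j _ => (hne j i).2
  · rw [hxz, eval_prod, eval_prod, ← Finset.prod_mul_distrib]
    refine Finset.prod_congr rfl fun j _ => ?_
    have h := (hne j i).2
    rcases hj : z j with _ | w
    · simp [rr]
    · rw [hj] at h
      simp only [Option.elim_some, eval_sub, eval_X, eval_C] at h
      have h' : w - (b i)⁻¹ ≠ 0 := by
        rw [← neg_sub]
        exact neg_ne_zero.2 h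
      simp only [rr, Option.elim_some, eval_sub, eval_X, eval_C]
      rw [div_mul_eq_mul_div, eq_div_iff h']
      ring

open Polynomial in
theorem mem_Wn_of_poly {g : ℕ} {b : Fin g → ℂ} {l : ℕ} {x : Fin g → ℂ} {P : ℂ[X]}
    (hdeg : P.natDegree ≤ l)
    (hP : ∀ i, P.eval (b i) ≠ 0 ∧ P.eval (b i)⁻¹ ≠ 0 ∧ P.eval (b i) = x i * P.eval (b i)⁻¹) :
    x ∈ Wn b l := by
  induction l generalizing x P with
  | zero =>
    refine ⟨fun _ => none, fun _ i => by simp, fun i => ?_⟩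
    obtain ⟨h1, -, h2⟩ := hP i
    rw [eq_C_of_natDegree_le_zero hdeg] at h1 h2
    rw [eval_C] at h1
    rw [eval_C, eval_C] at h2
    simpa using mul_right_cancel₀ h1 (h2.symm.trans (one_mul _).symm)
  | succ l ih =>
    rcases Nat.lt_or_ge l P.natDegree with h | h
    · have hd : P.degree ≠ 0 := by
        intro h0
        have h1 : P.natDegree = 0 := natDegree_eq_of_degree_eq_some h0
        omega
      obtain ⟨a, ha⟩ := IsAlgClosed.exists_root P hd
      obtain ⟨Q, rfl⟩ := dvd_iff_isRoot.2 ha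
      have hQ0 : Q ≠ 0 := by
        rintro rfl
        simp at h
      have hQdeg : Q.natDegree ≤ l := by
        rw [natDegree_mul (X_sub_C_ne_zero a) hQ0, natDegree_X_sub_C] at hdeg
        omega
      simp only [eval_mul, eval_sub, eval_X, eval_C, mul_ne_zero_iff] at hP
      obtain ⟨z, hz, hxz⟩ := ih (x := fun i => Q.eval (b i) / Q.eval (b i)⁻¹) hQdeg
        fun i => ⟨(hP i).1.2, (hP i).2.1.2, by rw [div_mul_cancel₀ _ (hP i).2.1.2]⟩
      refine ⟨Fin.cons (some a) z, ?_, fun i => ?_⟩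
      · refine Fin.cases ?_ hz
        intro i
        have h1 := (hP i).1.1
        have h2 := (hP i).2.1.1
        rw [sub_ne_zero] at h1 h2
        simpa using ⟨h1.symm, h2.symm⟩
      · obtain ⟨⟨h1, h2⟩, ⟨h3, h4⟩, h5⟩ := hP i
        rw [Fin.prod_univ_succ]
        simp only [Fin.cons_zero, Fin.cons_succ]
        rw [← hxz i]
        have h' : a - (b i)⁻¹ ≠ 0 := by
          rw [← neg_sub]
          exact neg_ne_zero.2 h3
        simp only [rr, Option.elim_some]
        rw [div_mul_div_comm, eq_div_iff (mul_ne_zero h' h4)]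
        linear_combination h5
    · obtain ⟨z, hz, hxz⟩ := ih h hP
      refine ⟨Fin.cons none z, ?_, fun i => ?_⟩
      · refine Fin.cases ?_ hz
        intro i
        simp
      · rw [Fin.prod_univ_succ, hxz i]
        simp [rr]

open Polynomial in
/-- The incidence variety of points `x` admitting a nonzero polynomial `P`, `deg P ≤ l`, with
`P(b_i) = x_i P(b_i⁻¹)` is closed. -/
theorem isClosed_setOf_exists_poly {g : ℕ} (b : Fin g → ℂ) (l : ℕ) :
    IsClosed {x : Fin g → ℂ | ∃ P : ℂ[X], P ≠ 0 ∧ P.natDegree ≤ l ∧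
      ∀ i, P.eval (b i) = x i * P.eval (b i)⁻¹} := by
  let S := Metric.sphere (0 : Fin (l + 1) → ℂ) 1
  let E : (Fin (l + 1) → ℂ) → ℂ → ℂ := fun c u => ∑ k, c k * u ^ (k : ℕ)
  have hE : ∀ u, Continuous fun c => E c u := fun u => by fun_prop
  have hK : IsClosed {p : (Fin g → ℂ) × S | ∀ i, E p.2 (b i) = p.1 i * E p.2 (b i)⁻¹} := by
    simp only [Set.ofPred_forall]
    refine isClosed_iInter fun i => isClosed_eq ?_ ?_
    · exact (hE _).comp (continuous_subtype_val.comp continuous_snd)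
    · exact ((continuous_apply i).comp continuous_fst).mul
        ((hE _).comp (continuous_subtype_val.comp continuous_snd))
  have : CompactSpace S := isCompact_iff_compactSpace.1 (isCompact_sphere _ _)
  convert isClosedMap_fst_of_compactSpace _ hK using 1
  ext x
  simp only [Set.mem_ofPred_eq, Set.mem_image, Prod.exists, exists_and_right, exists_eq_right]
  constructor
  · rintro ⟨P, hP0, hdeg, hP⟩
    let c : Fin (l + 1) → ℂ := fun k => P.coeff k
    have hE : ∀ u, P.eval u = E c u := fun u => by
      rw [eval_eq_sum_range' (Nat.lt_succ_of_le hdeg), ← Fin.sum_univ_eq_sum_range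
        (fun k => P.coeff k * u ^ k)]
    have hc : c ≠ 0 := by
      intro h
      have := congrFun h ⟨P.natDegree, Nat.lt_succ_of_le hdeg⟩
      exact hP0 (leadingCoeff_eq_zero.1 this)
    have hn : ‖c‖ ≠ 0 := norm_ne_zero_iff.2 hc
    refine ⟨⟨((‖c‖⁻¹ : ℝ) : ℂ) • c, ?_⟩, fun i => ?_⟩
    · simp [S, norm_smul, hn]
    · have hs : ∀ u, E (((‖c‖⁻¹ : ℝ) : ℂ) • c) u = ((‖c‖⁻¹ : ℝ) : ℂ) * P.eval u := fun u => by
        rw [hE]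
        simp only [E, Finset.mul_sum, Pi.smul_apply, smul_eq_mul, mul_assoc]
      rw [hs, hs, hP i]
      ring
  · rintro ⟨⟨c, hc⟩, h⟩
    let P : ℂ[X] := ∑ k : Fin (l + 1), C (c k) * X ^ (k : ℕ)
    have hE : ∀ u, P.eval u = E c u := fun u => by simp [P, E, eval_finsetSum]
    refine ⟨P, ?_, ?_, fun i => by rw [hE, hE]; exact h i⟩
    · intro hP
      have hc0 : c = 0 := by
        ext k
        have := congrArg (fun Q => coeff Q k) hP
        simpa [P, finsetSum_coeff, coeff_C_mul, coeff_X_pow, Fin.val_inj] using this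
      simp [S, hc0] at hc
    · refine natDegree_sum_le_of_forall_le _ _ fun k _ => ?_
      exact (natDegree_C_mul_X_pow_le _ _).trans (Nat.le_of_lt_succ k.2)

open Polynomial Filter Topology in
theorem mem_closure_Wn_of_poly {g : ℕ} {b : Fin g → ℂ} (hb : Function.Injective b)
    (hb' : ∀ i j, b i ≠ (b j)⁻¹) {l : ℕ} {x : Fin g → ℂ} (hx : x ∈ Torus g) {P : ℂ[X]}
    (hP0 : P ≠ 0) (hdeg : P.natDegree ≤ l) (hP : ∀ i, P.eval (b i) = x i * P.eval (b i)⁻¹) :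
    x ∈ closure (Wn b l) := by
  classical
  let J : Finset (Fin g) := Finset.univ.filter fun i => P.eval (b i)⁻¹ = 0
  let T : Finset (Fin g ⊕ Fin g) := J.disjSum J
  let v : Fin g ⊕ Fin g → ℂ := Sum.elim b fun i => (b i)⁻¹
  have hv : Function.Injective v := by
    refine hb.sumElim (fun i j h => hb (inv_injective h)) hb'
  have hroot : ∀ t ∈ T, v t ∈ P.roots.toFinset := by
    rintro (i | i) ht
    · have hi : P.eval (b i)⁻¹ = 0 := by simpa [T, J] using ht
      simpa [v, hP0, hi] using hP i
    · have hi : P.eval (b i)⁻¹ = 0 := by simpa [T, J] using ht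
      simpa [v, hP0] using hi
  have hcard : T.card ≤ l :=
    (Finset.card_le_card_of_injOn v hroot hv.injOn).trans
      ((Multiset.toFinset_card_le _).trans ((card_roots' P).trans hdeg))
  -- A perturbation direction with the prescribed ratios at the common zeros.
  let S : ℂ[X] := Lagrange.interpolate T v (Sum.elim x fun _ => 1)
  have hSdeg : S.natDegree ≤ l :=
    natDegree_le_of_degree_le ((Lagrange.degree_interpolate_lt _ hv.injOn).le.trans
      (by exact_mod_cast hcard))
  have hS1 : ∀ i ∈ J, S.eval (b i) = x i := fun i hi =>
    Lagrange.eval_interpolate_at_node (i := Sum.inl i) _ hv.injOn (by simpa [T] using hi)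
  have hS2 : ∀ i ∈ J, S.eval (b i)⁻¹ = 1 := fun i hi =>
    Lagrange.eval_interpolate_at_node (i := Sum.inr i) _ hv.injOn (by simpa [T] using hi)
  let y : ℂ → Fin g → ℂ := fun ε i =>
    (P.eval (b i) + ε * S.eval (b i)) / (P.eval (b i)⁻¹ + ε * S.eval (b i)⁻¹)
  have hlim : ∀ u, Tendsto (fun ε : ℂ => P.eval u + ε * S.eval u) (𝓝[≠] 0) (𝓝 (P.eval u)) := by
    intro u
    have : Continuous fun ε : ℂ => P.eval u + ε * S.eval u := by fun_prop
    simpa using this.continuousAt.tendsto.mono_left (nhdsWithin_le_nhds (a := (0 : ℂ)))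
  have hself : ∀ᶠ ε : ℂ in 𝓝[≠] 0, ε ≠ 0 := eventually_mem_nhdsWithin
  refine mem_closure_of_tendsto (f := y) (b := 𝓝[≠] (0 : ℂ)) ?_ ?_
  · refine tendsto_pi_nhds.2 fun i => ?_
    by_cases hi : i ∈ J
    · refine tendsto_const_nhds.congr' ?_
      filter_upwards [hself] with ε hε
      have h0 : P.eval (b i)⁻¹ = 0 := by simpa [J] using hi
      simp only [y, hS1 i hi, hS2 i hi, hP i, h0]
      rw [mul_zero, zero_add, zero_add, mul_one, mul_div_cancel_left₀ _ hε]
    · have h0 : P.eval (b i)⁻¹ ≠ 0 := by simpa [J] using hi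
      have := (hlim (b i)).div (hlim (b i)⁻¹) h0
      rwa [hP i, mul_div_cancel_right₀ _ h0, ← hP i] at this
  · have hne : ∀ i, ∀ᶠ ε : ℂ in 𝓝[≠] 0, P.eval (b i) + ε * S.eval (b i) ≠ 0 ∧
        P.eval (b i)⁻¹ + ε * S.eval (b i)⁻¹ ≠ 0 := by
      intro i
      by_cases hi : i ∈ J
      · filter_upwards [hself] with ε hε
        have h0 : P.eval (b i)⁻¹ = 0 := by simpa [J] using hi
        simpa [hS1 i hi, hS2 i hi, hP i, h0, hε] using hx i
      · have h0 : P.eval (b i)⁻¹ ≠ 0 := by simpa [J] using hi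
        have h1 : P.eval (b i) ≠ 0 := by
          rw [hP i]
          exact mul_ne_zero (hx i) h0
        exact ((hlim _).eventually_ne h1).and ((hlim _).eventually_ne h0)
    filter_upwards [eventually_all.2 hne] with ε hε
    refine mem_Wn_of_poly (P := P + C ε * S) ?_ fun i => ?_
    · exact (natDegree_add_le _ _).trans
        (max_le hdeg ((natDegree_C_mul_le _ _).trans hSdeg))
    · simp only [eval_add, eval_mul, eval_C]
      exact ⟨(hε i).1, (hε i).2, (div_mul_cancel₀ _ (hε i).2).symm⟩

open Polynomial in
theorem mem_closT_Wn_iff {g : ℕ} {b : Fin g → ℂ} (hb : Function.Injective b)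
    (hb' : ∀ i j, b i ≠ (b j)⁻¹) {l : ℕ} {x : Fin g → ℂ} :
    x ∈ closT (Wn b l) ↔ x ∈ Torus g ∧ ∃ P : ℂ[X], P ≠ 0 ∧ P.natDegree ≤ l ∧
      ∀ i, P.eval (b i) = x i * P.eval (b i)⁻¹ := by
  constructor
  · rintro ⟨hx, ht⟩
    refine ⟨ht, closure_minimal ?_ (isClosed_setOf_exists_poly b l) hx⟩
    intro y hy
    obtain ⟨P, hP0, hdeg, hP⟩ := exists_poly_of_mem_Wn hy
    exact ⟨P, hP0, hdeg, fun i => (hP i).2.2⟩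
  · rintro ⟨ht, P, hP0, hdeg, hP⟩
    exact ⟨mem_closure_Wn_of_poly hb hb' ht hP0 hdeg hP, ht⟩

theorem skip_injective {g : ℕ} (j : Fin g) : Function.Injective (skip j) := by
  intro a c h
  unfold skip at h
  split_ifs at h <;> simp only [Fin.mk.injEq] at h <;> ext <;> omega

theorem skip_ne {g : ℕ} (j : Fin g) (i : Fin (g - 1)) : skip j i ≠ j := by
  unfold skip
  split_ifs <;> simp only [ne_eq, Fin.ext_iff] <;> omega

theorem exists_skip_eq {g : ℕ} {i j : Fin g} (h : i ≠ j) : ∃ k, skip j k = i := by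
  rw [ne_eq, Fin.ext_iff] at h
  rcases Nat.lt_or_gt_of_ne h with h | h
  · exact ⟨⟨i, by omega⟩, by simp [skip, h]⟩
  · refine ⟨⟨i - 1, by omega⟩, ?_⟩
    unfold skip
    split_ifs with h'
    · simp only at h'
      omega
    · ext
      simp only
      omega

theorem W_natCast {g : ℕ} (b : Fin g → ℂ) (l : ℕ) : W b l = Wn b l := by
  ext x
  simp [W]

theorem W_of_neg {g : ℕ} (b : Fin g → ℂ) {l : ℤ} (hl : l < 0) : W b l = ∅ := by
  ext x
  simp only [W, Set.mem_ofPred_eq, Set.mem_empty_iff_false, iff_false, not_exists, not_and]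
  intro m hm
  omega

open Polynomial in
theorem exists_eq_quadratic_mul {a c : ℂ} (hac : a ≠ c) {P : ℂ[X]} (hP0 : P ≠ 0)
    (ha : P.eval a = 0) (hc : P.eval c = 0) :
    ∃ Q : ℂ[X], Q ≠ 0 ∧ Q.natDegree + 2 = P.natDegree ∧ P = (X - C a) * ((X - C c) * Q) := by
  obtain ⟨R, rfl⟩ := dvd_iff_isRoot.2 ha
  have hR : R.eval c = 0 := by
    simpa [sub_eq_zero, hac.symm] using hc
  obtain ⟨Q, rfl⟩ := dvd_iff_isRoot.2 hR
  have hR0 := right_ne_zero_of_mul hP0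
  have hQ0 := right_ne_zero_of_mul hR0
  refine ⟨Q, hQ0, ?_, rfl⟩
  rw [natDegree_mul (X_sub_C_ne_zero a) hR0, natDegree_mul (X_sub_C_ne_zero c) hQ0,
    natDegree_X_sub_C, natDegree_X_sub_C]
  omega

/-- The closure of `W_l` in `(ℂ^×)^g` is the union of `W_l` and
`δ ⋃_j π_j⁻¹(closure of W^{(j)}_{l-2})`; the latter set is described as the set of `x` in the
torus such that `π_j(δ⁻¹ x)` lies in the closure of `W^{(j)}_{l-2}` for some `j`. -/
theorem stmt5 (g : ℕ) (hg : 1 ≤ g) (ρ β b : Fin g → ℂ)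
    (hρdist : Function.Injective ρ) (hρ1 : ∀ i, ρ i ≠ 1 ∧ ρ i ≠ -1)
    (hβ : ∀ i, β i ^ 2 = ρ i ^ 2 - 1) (hbdef : ∀ i, b i = ρ i + β i)
    (hbinj : Function.Injective b) (hbInv : ∀ i j, b i ≠ (b j)⁻¹)
    (l : ℕ) (hl : l ≤ g) :
    closT (Wn b l) =
      Wn b l ∪ {x : Fin g → ℂ | x ∈ Torus g ∧ ∃ j : Fin g,
        (fun i => x (skip j i) / (b (skip j i)) ^ 2) ∈
          closT (W (fun i => b (skip j i)) ((l : ℤ) - 2))} := by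
  have hb0 : ∀ i, b i ≠ 0 := by
    intro i h0
    have h := hβ i
    rw [hbdef i] at h0
    rw [eq_neg_of_add_eq_zero_right h0] at h
    have : (1 : ℂ) = 0 := by linear_combination h
    exact one_ne_zero this
  have hinj : ∀ j, Function.Injective fun i => b (skip j i) := fun j =>
    hbinj.comp (skip_injective j)
  have hInv : ∀ j i k, b (skip j i) ≠ (b (skip j k))⁻¹ := fun j i k => hbInv _ _
  have hquad : ∀ i j, (b i - b j) * (b i - (b j)⁻¹) =
      b i ^ 2 * (((b i)⁻¹ - b j) * ((b i)⁻¹ - (b j)⁻¹)) := by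
    intro i j
    have hi := hb0 i
    have hj := hb0 j
    field_simp
    ring
  ext x
  rw [mem_closT_Wn_iff hbinj hbInv]
  simp only [Set.mem_union, Set.mem_ofPred_eq]
  constructor
  · rintro ⟨ht, P, hP0, hdeg, hP⟩
    by_cases hz : ∀ i, P.eval (b i)⁻¹ ≠ 0
    · refine Or.inl (mem_Wn_of_poly hdeg fun i => ⟨?_, hz i, hP i⟩)
      rw [hP i]
      exact mul_ne_zero (ht i) (hz i)
    · push Not at hz
      obtain ⟨j, hj⟩ := hz
      have hj' : P.eval (b j) = 0 := by rw [hP j, hj, mul_zero]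
      obtain ⟨Q, hQ0, hQdeg, rfl⟩ := exists_eq_quadratic_mul (hbInv j j) hP0 hj' hj
      refine Or.inr ⟨ht, j, ?_⟩
      have hl2 : (l : ℤ) - 2 = ((l - 2 : ℕ) : ℤ) := by omega
      rw [hl2, W_natCast, mem_closT_Wn_iff (hinj j) (hInv j)]
      refine ⟨fun i => div_ne_zero (ht _) (pow_ne_zero 2 (hb0 _)), Q, hQ0, by omega, fun i => ?_⟩
      have h := hP (skip j i)
      have hij := skip_ne j i
      generalize skip j i = k at h hij ⊢
      simp only [Polynomial.eval_mul, Polynomial.eval_sub, Polynomial.eval_X, Polynomial.eval_C] at h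
      have h1 : b k - b j ≠ 0 := sub_ne_zero.2 (hbinj.ne hij)
      have h2 : b k - (b j)⁻¹ ≠ 0 := sub_ne_zero.2 (hbInv _ _)
      have hk : b k ^ 2 ≠ 0 := pow_ne_zero 2 (hb0 k)
      rw [div_mul_eq_mul_div, eq_div_iff hk]
      refine mul_left_cancel₀ (mul_ne_zero h1 h2) ?_
      linear_combination b k ^ 2 * h - x k * Q.eval (b k)⁻¹ * hquad k j
  · rintro (hx | ⟨ht, j, hj⟩)
    · refine (mem_closT_Wn_iff hbinj hbInv).1 ⟨subset_closure hx, fun i => ?_⟩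
      obtain ⟨P, -, -, hP⟩ := exists_poly_of_mem_Wn hx
      exact left_ne_zero_of_mul ((hP i).2.2 ▸ (hP i).1)
    · refine ⟨ht, ?_⟩
      rcases Nat.lt_or_ge l 2 with hl2 | hl2
      · rw [W_of_neg _ (by omega)] at hj
        simp [closT] at hj
      · have hl' : (l : ℤ) - 2 = ((l - 2 : ℕ) : ℤ) := by omega
        rw [hl', W_natCast, mem_closT_Wn_iff (hinj j) (hInv j)] at hj
        obtain ⟨-, Q, hQ0, hQdeg, hQ⟩ := hj
        refine ⟨(.X - .C (b j)) * ((.X - .C (b j)⁻¹) * Q), ?_, ?_, fun i => ?_⟩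
        · exact mul_ne_zero (Polynomial.X_sub_C_ne_zero _) (mul_ne_zero (Polynomial.X_sub_C_ne_zero _) hQ0)
        · rw [Polynomial.natDegree_mul (Polynomial.X_sub_C_ne_zero _) (mul_ne_zero (Polynomial.X_sub_C_ne_zero _) hQ0),
            Polynomial.natDegree_mul (Polynomial.X_sub_C_ne_zero _) hQ0, Polynomial.natDegree_X_sub_C, Polynomial.natDegree_X_sub_C]
          omega
        · simp only [Polynomial.eval_mul, Polynomial.eval_sub, Polynomial.eval_X, Polynomial.eval_C]
          by_cases hij : i = j
          · simp [hij]
          · obtain ⟨k, rfl⟩ := exists_skip_eq hij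
            have h := hQ k
            have hk : b (skip j k) ^ 2 ≠ 0 := pow_ne_zero 2 (hb0 _)
            rw [div_mul_eq_mul_div, eq_div_iff hk] at h
            linear_combination Q.eval (b (skip j k)) * hquad (skip j k) j +
              ((b (skip j k))⁻¹ - b j) * ((b (skip j k))⁻¹ - (b j)⁻¹) * h
end

section
/- Let D ∈ ℂ[t] be monic of degree 2d, not the square of a polynomial, and let f ∈ ℂ((t⁻¹)) be the square root of D with leading term t^d. Let p, q ∈ ℂ[t] with q ≠ 0 and ord(p − q f) ≥ deg q + 1. Then p ≠ 0, deg p = deg q + d, the polynomial p² − D q² is nonzero of degree deg q + d − ord(p − q f); in particular ord(p − q f) ≤ deg q + d, with equality if and only if p² − D q² is a nonzero constant. -/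
/-- The element `t` of `ℂ((t⁻¹))`: we model `ℂ((t⁻¹))` as the field `LaurentSeries ℂ` of formal
Laurent series in the variable `X = t⁻¹`, so `t` is the inverse of the variable,
i.e. the Hahn series `X⁻¹`. -/
noncomputable def tK : LaurentSeries ℂ := HahnSeries.single (-1 : ℤ) 1

/-- The embedding `ℂ[t] → ℂ((t⁻¹))`, sending a polynomial `p` to `p(t)`. -/
noncomputable def emb (p : Polynomial ℂ) : LaurentSeries ℂ := Polynomial.aeval tK p

/-- `ord(h)` = the order of vanishing at infinity: for `h = Σ_{n ≤ n₀} c_n tⁿ` nonzero it is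
`−max{n : c_n ≠ 0}`, i.e. the Hahn-series order (least exponent of `t⁻¹` in the support),
and `ord 0 = ⊤`. -/
noncomputable def ordE (h : LaurentSeries ℂ) : WithTop ℤ :=
  letI := Classical.propDecidable (h = 0)
  if h = 0 then ⊤ else (h.order : WithTop ℤ)

theorem coeff_emb (p : Polynomial ℂ) (k : ℤ) :
    (emb p).coeff k = if k ≤ 0 then p.coeff (-k).toNat else 0 := by
  have hpow (i : ℕ) : tK ^ i = HahnSeries.single (-(i : ℤ)) 1 := by
    simp [tK, HahnSeries.single_pow]
  have hC (a : ℂ) : algebraMap ℂ (LaurentSeries ℂ) a = HahnSeries.single 0 a := by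
    simp [HahnSeries.algebraMap_apply']
  rw [emb, Polynomial.aeval_def, Polynomial.eval₂_eq_sum_range, HahnSeries.coeff_sum]
  simp only [hpow, hC, HahnSeries.single_mul_single, zero_add, mul_one, HahnSeries.coeff_single]
  split_ifs with hk
  · have h (i : ℕ) : k = -(i : ℤ) ↔ (-k).toNat = i := by omega
    simp only [h, Finset.sum_ite_eq, Finset.mem_range]
    split_ifs with hlt
    · rfl
    · exact (Polynomial.coeff_eq_zero_of_natDegree_lt (by omega)).symm
  · exact Finset.sum_eq_zero fun i _ => if_neg (by omega)

theorem orderTop_emb {p : Polynomial ℂ} (hp : p ≠ 0) :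
    (emb p).orderTop = ((-(p.natDegree : ℤ) : ℤ) : WithTop ℤ) := by
  apply le_antisymm
  · apply HahnSeries.orderTop_le_of_coeff_ne_zero
    rw [coeff_emb]
    simpa using hp
  · refine HahnSeries.le_orderTop_iff_forall.mpr fun k hk => ?_
    have hk' : k < -(p.natDegree : ℤ) := by exact_mod_cast hk
    rw [coeff_emb, if_pos (by omega)]
    exact Polynomial.coeff_eq_zero_of_natDegree_lt (by omega)

theorem emb_ne_zero {p : Polynomial ℂ} (hp : p ≠ 0) : emb p ≠ 0 := by
  rw [← HahnSeries.orderTop_ne_top, orderTop_emb hp]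
  exact WithTop.coe_ne_top

theorem order_emb {p : Polynomial ℂ} (hp : p ≠ 0) : (emb p).order = -(p.natDegree : ℤ) := by
  have h := HahnSeries.order_eq_orderTop_of_ne_zero (emb_ne_zero hp)
  rw [orderTop_emb hp] at h
  exact_mod_cast h

theorem ordE_eq_orderTop (h : LaurentSeries ℂ) : ordE h = h.orderTop := by
  unfold ordE
  split_ifs with h0
  · simp [h0]
  · exact HahnSeries.order_eq_orderTop_of_ne_zero h0

theorem stmt7 (d : ℕ) (D : Polynomial ℂ) (hmonic : D.Monic) (hdeg : D.natDegree = 2 * d)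
    (hnsq : ¬∃ s : Polynomial ℂ, D = s ^ 2)
    (f : LaurentSeries ℂ) (hf2 : f ^ 2 = emb D) (hlead : f.coeff (-(d : ℤ)) = 1)
    (p q : Polynomial ℂ) (hq : q ≠ 0)
    (hord : (((q.natDegree : ℤ) + 1 : ℤ) : WithTop ℤ) ≤ ordE (emb p - emb q * f)) :
    p ≠ 0 ∧ emb p - emb q * f ≠ 0 ∧ p.natDegree = q.natDegree + d ∧
      p ^ 2 - D * q ^ 2 ≠ 0 ∧
      ((p ^ 2 - D * q ^ 2).natDegree : ℤ) =
        (q.natDegree : ℤ) + d - (emb p - emb q * f).order ∧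
      (emb p - emb q * f).order ≤ (q.natDegree : ℤ) + d ∧
      ((emb p - emb q * f).order = (q.natDegree : ℤ) + d ↔
        ∃ c : ℂ, c ≠ 0 ∧ p ^ 2 - D * q ^ 2 = Polynomial.C c) := by
  have hD : D ≠ 0 := hmonic.ne_zero
  have hfne : f ≠ 0 := by
    rintro rfl
    simp at hlead
  have hford : f.order = -(d : ℤ) := by
    have h := congrArg HahnSeries.order hf2
    rw [sq, HahnSeries.order_mul hfne hfne, order_emb hD, hdeg] at h
    push_cast at h
    omega
  have hqf : emb q * f ≠ 0 := mul_ne_zero (emb_ne_zero hq) hfne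
  have hqford : (emb q * f).orderTop = ((-((q.natDegree : ℤ) + d) : ℤ) : WithTop ℤ) := by
    rw [← HahnSeries.order_eq_orderTop_of_ne_zero hqf,
      HahnSeries.order_mul (emb_ne_zero hq) hfne, order_emb hq, hford]
    congr 1
    ring
  set r := emb p - emb q * f with hr
  rw [ordE_eq_orderTop] at hord
  have hlt : ((-((q.natDegree : ℤ) + d) : ℤ) : WithTop ℤ) < r.orderTop :=
    lt_of_lt_of_le (WithTop.coe_lt_coe.mpr (by omega)) hord
  have hpord : (emb p).orderTop = ((-((q.natDegree : ℤ) + d) : ℤ) : WithTop ℤ) := by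
    have h : emb p = emb q * f + r := by rw [hr]; ring
    rw [h, HahnSeries.orderTop_add_eq_left (by rwa [hqford]), hqford]
  have hp : p ≠ 0 := by
    rintro rfl
    rw [emb, map_zero, HahnSeries.orderTop_zero] at hpord
    exact WithTop.coe_ne_top hpord.symm
  have hpdeg : p.natDegree = q.natDegree + d := by
    rw [orderTop_emb hp] at hpord
    have h := WithTop.coe_injective hpord
    omega
  have hsord : (emb p + emb q * f).orderTop = ((-((q.natDegree : ℤ) + d) : ℤ) : WithTop ℤ) := by
    have h2 : (emb p + emb p).orderTop = (emb p).orderTop := by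
      have h : emb p + emb p = emb (Polynomial.C 2 * p) := by
        rw [emb, ← map_add, ← two_mul]; rfl
      have h2p : Polynomial.C (2 : ℂ) * p ≠ 0 := by simp [hp]
      rw [h, orderTop_emb h2p, orderTop_emb hp, Polynomial.natDegree_C_mul two_ne_zero]
    have h : emb p + emb q * f = emb p + emb p - r := by
      rw [hr]; ring
    rw [h, HahnSeries.orderTop_sub (by rwa [h2, hpord]), h2, hpord]
  have hs : emb p + emb q * f ≠ 0 := by
    rw [← HahnSeries.orderTop_ne_top, hsord]
    exact WithTop.coe_ne_top
  have hN : p ^ 2 - D * q ^ 2 ≠ 0 := by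
    intro h0
    have h := sub_eq_zero.mp h0
    obtain ⟨s, rfl⟩ : q ∣ p :=
      (UniqueFactorizationMonoid.pow_dvd_pow_iff_dvd two_ne_zero).mp ⟨D, by rw [h, mul_comm]⟩
    refine hnsq ⟨s, mul_right_cancel₀ (pow_ne_zero 2 hq) ?_⟩
    rw [← h]; ring
  have hfac : emb (p ^ 2 - D * q ^ 2) = r * (emb p + emb q * f) := by
    have h : emb (p ^ 2 - D * q ^ 2) = emb p ^ 2 - emb D * emb q ^ 2 := by simp [emb]
    rw [h, ← hf2, hr]; ring
  have hrne : r ≠ 0 := by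
    intro h0
    exact emb_ne_zero hN (by rw [hfac, h0, zero_mul])
  have hdegN : ((p ^ 2 - D * q ^ 2).natDegree : ℤ) = (q.natDegree : ℤ) + d - r.order := by
    have h := congrArg HahnSeries.order hfac
    have h' := HahnSeries.order_eq_orderTop_of_ne_zero hs
    rw [hsord] at h'
    rw [order_emb hN, HahnSeries.order_mul hrne hs, WithTop.coe_injective h'] at h
    omega
  refine ⟨hp, hrne, hpdeg, hN, hdegN, by omega, fun h => ?_, ?_⟩
  · have h0 : (p ^ 2 - D * q ^ 2).natDegree = 0 := by omega
    obtain ⟨c, hc⟩ := Polynomial.natDegree_eq_zero.mp h0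
    refine ⟨c, ?_, hc.symm⟩
    rintro rfl
    exact hN (by rw [← hc, Polynomial.C_0])
  · rintro ⟨c, -, hc⟩
    rw [hc, Polynomial.natDegree_C] at hdegN
    push_cast at hdegN
    omega
end
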